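/- arXiv:1607.08556 — 3 statements merged into one kernel-verified Lean document; each statement's English description precedes it below -/
import Mathlib

section
/- Let M ⊆ ℝ^n be a connected open set, let Ψ: M → M' ⊆ ℝ^{n−r} be a reduction map, let Y_1,…,Y_k be reduction vector fields for Ψ, and set 𝒢 = the C^∞(M)-module spanned by Y_1,…,Y_k. If Y is a smooth vector field on M such that [Y, Y_i] ∈ 𝒢 for every i = 1,…,k, then there exists a unique smooth vector field Y' on M' such that ∇Ψ · Y = Y' ∘ Ψ. -/
noncomputable section

open scoped BigOperators

/-- Partial derivative `∂_j f` at `x`. -/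
def pd {d : ℕ} (f : (Fin d → ℝ) → ℝ) (j : Fin d) (x : Fin d → ℝ) : ℝ :=
  fderiv ℝ f x (Pi.single j 1)

/-- A vector field `Y` applied to a scalar function: `Y(f) = ∑ k Y^k ∂_k f`. -/
def vfApp {d : ℕ} (Y : (Fin d → ℝ) → Fin d → ℝ) (f : (Fin d → ℝ) → ℝ)
    (x : Fin d → ℝ) : ℝ :=
  ∑ k, Y x k * pd f k x

/-- Lie bracket of two vector fields. -/
def vfBracket {d : ℕ} (X Y : (Fin d → ℝ) → Fin d → ℝ) (x : Fin d → ℝ) :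
    Fin d → ℝ :=
  fun i => ∑ k, (X x k * pd (fun y => Y y i) k x - Y x k * pd (fun y => X y i) k x)

/-- The bracket `[H,K]` of a vector field `H` with a matrix-valued map `K`. -/
def mixBracket {d m : ℕ} (H : (Fin d → ℝ) → Fin d → ℝ)
    (K : (Fin d → ℝ) → Fin d → Fin m → ℝ) (x : Fin d → ℝ) : Fin d → Fin m → ℝ :=
  fun i j => ∑ k, (H x k * pd (fun y => K y i j) k x - K x k j * pd (fun y => H y i) k x)

/-- The generator `L` of the SDE `(μ,σ)`. -/
def gen {d m : ℕ} (μ : (Fin d → ℝ) → Fin d → ℝ)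
    (σ : (Fin d → ℝ) → Fin d → Fin m → ℝ)
    (f : (Fin d → ℝ) → ℝ) (x : Fin d → ℝ) : ℝ :=
  (1/2) * ∑ α : Fin m, ∑ i, ∑ j, σ x i α * σ x j α * pd (fun y => pd f j y) i x
    + ∑ i, μ x i * pd f i x

/-- The determining equations: `(Y,C,τ)` is an infinitesimal symmetry of `(μ,σ)` on `M`. -/
def IsSymmetry {d m : ℕ} (M : Set (Fin d → ℝ))
    (μ : (Fin d → ℝ) → Fin d → ℝ) (σ : (Fin d → ℝ) → Fin d → Fin m → ℝ)
    (Y : (Fin d → ℝ) → Fin d → ℝ) (C : (Fin d → ℝ) → Fin m → Fin m → ℝ)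
    (τ : (Fin d → ℝ) → ℝ) : Prop :=
  (∀ x ∈ M, ∀ i α, mixBracket Y σ x i α
      = -(1/2) * τ x * σ x i α - ∑ β, σ x i β * C x β α) ∧
  (∀ x ∈ M, ∀ i,
      vfApp Y (fun y => μ y i) x - gen μ σ (fun y => Y y i) x = - τ x * μ x i)

open Filter Topology

section Factorization

variable {E F H : Type*} [NormedAddCommGroup E] [NormedSpace ℝ E]
  [NormedAddCommGroup F] [NormedSpace ℝ F] [NormedAddCommGroup H] [NormedSpace ℝ H]

theorem ContDiffAt.eventually_differentiableAt {m : WithTop ℕ∞} {f : E → F} {x : E}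
    (hf : ContDiffAt ℝ m f x) (hm : m ≠ 0) : ∀ᶠ y in 𝓝 x, DifferentiableAt ℝ f y :=
  ((hf.of_le (ENat.one_le_iff_ne_zero_withTop.mpr hm)).eventually (by simp)).mono
    fun _ hy => hy.differentiableAt one_ne_zero

/-- If `[Z, Y]` and `Y` are annihilated by the derivative of `Ψ`, then so is the derivative of
`fderiv ℝ Ψ · (Z ·)` along `Y`. -/
theorem fderiv_fderiv_apply_eq_zero_of_lieBracket {M : Set E} (hM : IsOpen M) {Ψ : E → F}
    (hΨ : ContDiffOn ℝ 2 Ψ M) {Y Z : E → E} {x : E} (hx : x ∈ M)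
    (hY : DifferentiableAt ℝ Y x) (hZ : DifferentiableAt ℝ Z x)
    (hΨY : ∀ z ∈ M, fderiv ℝ Ψ z (Y z) = 0)
    (hbr : fderiv ℝ Ψ x (VectorField.lieBracket ℝ Z Y x) = 0) :
    fderiv ℝ (fun z => fderiv ℝ Ψ z (Z z)) x (Y x) = 0 := by
  have h := VectorField.fderiv_apply_lieBracket (hΨ.contDiffAt (hM.mem_nhds hx)) (by simp) hY hZ
  have h0 : fderiv ℝ (fun z => fderiv ℝ Ψ z (Y z)) x = 0 := by
    rw [EventuallyEq.fderiv_eq (eventually_of_mem (hM.mem_nhds hx) hΨY)]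
    simp
  rw [hbr, h0] at h
  simpa using h.symm

variable [CompleteSpace E] [FiniteDimensional ℝ F]

/-- Near a point where `Ψ` is a submersion, a `C^m` map whose derivative vanishes on the kernel of
the derivative of `Ψ` factors through `Ψ` by a `C^m` map. -/
theorem exists_contDiffAt_eventuallyEq_comp {m : WithTop ℕ∞} (hm : m ≠ 0) {Ψ : E → F} {G : E → H}
    {a : E} (hΨ : ContDiffAt ℝ m Ψ a) (hG : ContDiffAt ℝ m G a)
    (hsurj : (fderiv ℝ Ψ a).range = ⊤)
    (hker : ∀ᶠ x in 𝓝 a, ∀ v, fderiv ℝ Ψ x v = 0 → fderiv ℝ G x v = 0) :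
    ∃ g : F → H, ContDiffAt ℝ m g (Ψ a) ∧ ∀ᶠ x in 𝓝 a, G x = g (Ψ x) := by
  have : CompleteSpace F := FiniteDimensional.complete ℝ F
  let φ := HasStrictFDerivAt.implicitFunctionDataOfComplemented Ψ (fderiv ℝ Ψ a)
    (hΨ.hasStrictFDerivAt hm) hsurj
    (fderiv ℝ Ψ a).ker_closedComplemented_of_finiteDimensional_range
  have hr : ContDiff ℝ m φ.rightFun :=
    φ.rightDeriv.contDiff.comp (contDiff_id.sub contDiff_const)
  have hpt : φ.implicitFunction (Ψ a) (φ.rightFun a) = a :=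
    φ.implicitFunction_apply_image.self_of_nhds
  let b : F × (fderiv ℝ Ψ a).ker := (Ψ a, φ.rightFun a)
  let s : F × (fderiv ℝ Ψ a).ker → E := fun q => φ.implicitFunction q.1 q.2
  have hs : ContDiffAt ℝ m s b := φ.contDiffAt_implicitFunction hΨ hr.contDiffAt hm
  have hsb : s b = a := hpt
  have hGs : ContDiffAt ℝ m (G ∘ s) b := ContDiffAt.comp b (by rwa [hsb]) hs
  have hs_tendsto : Tendsto s (𝓝 b) (𝓝 a) := by
    simpa only [hsb] using hs.continuousAt.tendsto
  have hΨs : ∀ᶠ q in 𝓝 b, Ψ (s q) = q.1 := φ.leftFun_implicitFunction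
  have hgood : ∀ᶠ q in 𝓝 b, DifferentiableAt ℝ s q ∧ DifferentiableAt ℝ Ψ (s q) ∧
      DifferentiableAt ℝ G (s q) ∧ (∀ᶠ q' in 𝓝 q, Ψ (s q') = q'.1) ∧
      ∀ v, fderiv ℝ Ψ (s q) v = 0 → fderiv ℝ G (s q) v = 0 := by
    filter_upwards [hs.eventually_differentiableAt hm,
      hs_tendsto.eventually (hΨ.eventually_differentiableAt hm),
      hs_tendsto.eventually (hG.eventually_differentiableAt hm),
      hΨs.eventually_nhds, hs_tendsto.eventually hker] with q h₁ h₂ h₃ h₄ h₅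
    exact ⟨h₁, h₂, h₃, h₄, h₅⟩
  obtain ⟨ε, hε, hball⟩ := Metric.eventually_nhds_iff_ball.mp hgood
  have hconst : ∀ q ∈ Metric.ball b ε, G (s q) = G (s (q.1, b.2)) := by
    rintro ⟨y, k⟩ hq
    rw [← ball_prod_same, Set.mem_prod] at hq
    have hderiv : ∀ l ∈ Metric.ball b.2 ε,
        HasFDerivAt (fun l => G (s (y, l))) (0 : (fderiv ℝ Ψ a).ker →L[ℝ] H) l := by
      intro l hl
      obtain ⟨h₁, h₂, h₃, h₄, h₅⟩ := hball (y, l) (by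
        rw [← ball_prod_same]; exact ⟨hq.1, hl⟩)
      have hsl : HasFDerivAt (fun l => s (y, l)) _ l :=
        h₁.hasFDerivAt.comp l (hasFDerivAt_prodMk_right y l)
      have hΨsl := h₂.hasFDerivAt.comp l hsl
      have hy : HasFDerivAt (fun l => Ψ (s (y, l))) (0 : (fderiv ℝ Ψ a).ker →L[ℝ] F) l :=
        (hasFDerivAt_const y l).congr_of_eventuallyEq
          ((Continuous.prodMk_right y).continuousAt.eventually h₄)
      have h0 := hΨsl.unique hy
      have hGsl := h₃.hasFDerivAt.comp l hsl
      refine hGsl.congr_fderiv ?_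
      ext v
      exact h₅ _ (DFunLike.congr_fun h0 v)
    exact Metric.isOpen_ball.is_const_of_fderiv_eq_zero (𝕜 := ℝ)
      (convex_ball b.2 ε).isPreconnected
      (fun l hl => (hderiv l hl).differentiableAt.differentiableWithinAt)
      (fun l hl => (hderiv l hl).fderiv) hq.2 (Metric.mem_ball_self hε)
  refine ⟨fun y => G (s (y, b.2)), ?_, ?_⟩
  · exact ContDiffAt.comp (Ψ a) (g := G ∘ s) hGs (contDiffAt_id.prodMk contDiffAt_const)
  · have hcont : Tendsto (fun x => (Ψ x, φ.rightFun x)) (𝓝 a) (𝓝 b) :=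
      hΨ.continuousAt.prodMk hr.continuous.continuousAt
    filter_upwards [hcont.eventually (Metric.ball_mem_nhds b hε),
      φ.implicitFunction_apply_image] with x hx hx'
    have hsx : s (Ψ x, φ.rightFun x) = x := hx'
    simpa only [hsx] using hconst _ hx

/-- A `C^m` map on an open set whose derivative vanishes on the kernel of the derivative of a
submersion `Ψ` with connected fibres factors globally through `Ψ` by a `C^m` map. -/
theorem exists_contDiffOn_eq_comp {m : WithTop ℕ∞} (hm : m ≠ 0) {M : Set E} (hM : IsOpen M)
    {Ψ : E → F} {G : E → H} (hΨ : ContDiffOn ℝ m Ψ M) (hG : ContDiffOn ℝ m G M)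
    (hsurj : ∀ x ∈ M, (fderiv ℝ Ψ x).range = ⊤)
    (hfib : ∀ y ∈ Ψ '' M, IsPreconnected {x ∈ M | Ψ x = y})
    (hker : ∀ x ∈ M, ∀ v, fderiv ℝ Ψ x v = 0 → fderiv ℝ G x v = 0) :
    ∃ g : F → H, ContDiffOn ℝ m g (Ψ '' M) ∧ ∀ x ∈ M, G x = g (Ψ x) := by
  have : CompleteSpace F := FiniteDimensional.complete ℝ F
  have hloc : ∀ x ∈ M, ∃ g : F → H, ContDiffAt ℝ m g (Ψ x) ∧ ∀ᶠ z in 𝓝 x, G z = g (Ψ z) :=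
    fun x hx => exists_contDiffAt_eventuallyEq_comp hm (hΨ.contDiffAt (hM.mem_nhds hx))
      (hG.contDiffAt (hM.mem_nhds hx)) (hsurj x hx)
      (eventually_of_mem (hM.mem_nhds hx) hker)
  have hfiber : ∀ x ∈ M, ∀ x' ∈ M, Ψ x = Ψ x' → G x = G x' := by
    intro x hx x' hx' hxx'
    have : PreconnectedSpace {z ∈ M | Ψ z = Ψ x'} :=
      isPreconnected_iff_preconnectedSpace.mp (hfib _ ⟨x', hx', rfl⟩)
    have hlc : IsLocallyConstant (fun z : {z ∈ M | Ψ z = Ψ x'} => G z) := by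
      rw [IsLocallyConstant.iff_eventually_eq]
      rintro ⟨z, hz, hzx⟩
      obtain ⟨g, -, hg⟩ := hloc z hz
      filter_upwards [continuous_subtype_val.continuousAt.eventually hg] with w hw
      rw [hw, hg.self_of_nhds, w.2.2, hzx]
    exact hlc.apply_eq_of_preconnectedSpace ⟨x, hx, hxx'⟩ ⟨x', hx', rfl⟩
  have hex : ∀ x ∈ M, G x = G (Function.invFunOn Ψ M (Ψ x)) := fun x hx =>
    hfiber x hx _ (Function.invFunOn_mem ⟨x, hx, rfl⟩) (Function.invFunOn_eq ⟨x, hx, rfl⟩).symm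
  refine ⟨fun y => G (Function.invFunOn Ψ M y), ?_, hex⟩
  rintro _ ⟨x, hx, rfl⟩
  obtain ⟨g, hgs, hg⟩ := hloc x hx
  refine (hgs.congr_of_eventuallyEq ?_).contDiffWithinAt
  have hmap := ((hΨ.contDiffAt (hM.mem_nhds hx)).hasStrictFDerivAt hm).map_nhds_eq_of_surj
    (hsurj x hx)
  rw [EventuallyEq, ← hmap, eventually_map]
  filter_upwards [hg, hM.mem_nhds hx] with z hz hzM
  rw [← hex z hzM, hz]

end Factorization

theorem sum_pd_mul_eq_fderiv {d p : ℕ} {Ψ : (Fin d → ℝ) → Fin p → ℝ} {x : Fin d → ℝ}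
    (h : DifferentiableAt ℝ Ψ x) (v : Fin d → ℝ) (i : Fin p) :
    ∑ j, pd (fun y => Ψ y i) j x * v j = fderiv ℝ Ψ x v i := by
  have hi : fderiv ℝ (fun y => Ψ y i) x v = fderiv ℝ Ψ x v i := by
    rw [fderiv_apply h]
    rfl
  rw [← hi]
  conv_rhs => rw [pi_eq_sum_univ' v]
  simp [pd, mul_comm]

theorem vfBracket_eq_lieBracket {d : ℕ} {X Y : (Fin d → ℝ) → Fin d → ℝ} {x : Fin d → ℝ}
    (hX : DifferentiableAt ℝ X x) (hY : DifferentiableAt ℝ Y x) :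
    vfBracket X Y x = VectorField.lieBracket ℝ X Y x := by
  ext i
  simp only [vfBracket, VectorField.lieBracket, Pi.sub_apply, Finset.sum_sub_distrib,
    ← sum_pd_mul_eq_fderiv hX, ← sum_pd_mul_eq_fderiv hY, mul_comm]

/-- Proposition 2.5, second part.  If `Ψ : M → M'` is a reduction map with
reduction vector fields `Y_1,…,Y_k` and `Y` is a vector field with `[Y,Y_i]` in the
`C^∞(M)`-module spanned by the `Y_i`, then `∇Ψ · Y` factors uniquely through `Ψ` as a smooth
vector field on `M'`. -/
theorem reduction_map_factor_vector_field
    {n p k r : ℕ} (hrn : r ≤ n) (hp : p = n - r)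
    (M : Set (Fin n → ℝ)) (hMopen : IsOpen M) (hMconn : IsConnected M)
    (M' : Set (Fin p → ℝ)) (hM'open : IsOpen M')
    (Ψ : (Fin n → ℝ) → Fin p → ℝ)
    (hΨsmooth : ContDiffOn ℝ (⊤ : ℕ∞) Ψ M)
    (hΨim : Ψ '' M = M')
    (hΨsubm : ∀ x ∈ M, Function.Surjective
      (fun v : Fin n → ℝ => (fun i => ∑ j, pd (fun y => Ψ y i) j x * v j : Fin p → ℝ)))
    (hfib : ∀ y ∈ M', IsConnected {x ∈ M | Ψ x = y})
    (Y : Fin k → (Fin n → ℝ) → Fin n → ℝ)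
    (hYsmooth : ∀ i, ContDiffOn ℝ (⊤ : ℕ∞) (Y i) M)
    (hrank : ∀ x ∈ M,
      Module.finrank ℝ (Submodule.span ℝ (Set.range fun i => Y i x)) = r)
    (hintegrable : ∀ i j, ∀ x ∈ M,
      vfBracket (Y i) (Y j) x ∈ Submodule.span ℝ (Set.range fun l => Y l x))
    (hker : ∀ x ∈ M, ∀ v : Fin n → ℝ,
      v ∈ Submodule.span ℝ (Set.range fun i => Y i x) ↔
        ∀ i, ∑ j, pd (fun y => Ψ y i) j x * v j = 0)
    (Z : (Fin n → ℝ) → Fin n → ℝ) (hZsmooth : ContDiffOn ℝ (⊤ : ℕ∞) Z M)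
    (hZbr : ∀ i, ∃ lam : Fin k → (Fin n → ℝ) → ℝ,
      (∀ j, ContDiffOn ℝ (⊤ : ℕ∞) (lam j) M) ∧
      ∀ x ∈ M, vfBracket Z (Y i) x = ∑ j, lam j x • Y j x) :
    ∃ Z' : (Fin p → ℝ) → Fin p → ℝ, ContDiffOn ℝ (⊤ : ℕ∞) Z' M' ∧
      (∀ x ∈ M, ∀ i, ∑ j, pd (fun y => Ψ y i) j x * Z x j = Z' (Ψ x) i) ∧
      ∀ W : (Fin p → ℝ) → Fin p → ℝ, ContDiffOn ℝ (⊤ : ℕ∞) W M' →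
        (∀ x ∈ M, ∀ i, ∑ j, pd (fun y => Ψ y i) j x * Z x j = W (Ψ x) i) →
        ∀ y ∈ M', W y = Z' y := by
  have htwo : (2 : WithTop ℕ∞) ≤ (⊤ : ℕ∞) := WithTop.coe_le_coe.mpr le_top
  have hne : ((⊤ : ℕ∞) : WithTop ℕ∞) ≠ 0 := by simp
  have hdiff {q : ℕ} {f : (Fin n → ℝ) → Fin q → ℝ} (hf : ContDiffOn ℝ (⊤ : ℕ∞) f M) :
      ∀ x ∈ M, DifferentiableAt ℝ f x := fun x hx =>
    (hf.contDiffAt (hMopen.mem_nhds hx)).differentiableAt hne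
  have hpd (x) (hx : x ∈ M) (v) : (fun i => ∑ j, pd (fun y => Ψ y i) j x * v j) =
      fderiv ℝ Ψ x v := funext (sum_pd_mul_eq_fderiv (hdiff hΨsmooth x hx) v)
  have hker' (x) (hx : x ∈ M) (v) :
      v ∈ Submodule.span ℝ (Set.range fun i => Y i x) ↔ fderiv ℝ Ψ x v = 0 := by
    rw [hker x hx, ← hpd x hx, funext_iff]
    rfl
  have hΨY (i) (x) (hx : x ∈ M) : fderiv ℝ Ψ x (Y i x) = 0 :=
    (hker' x hx _).mp (Submodule.subset_span ⟨i, rfl⟩)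
  have hG : ContDiffOn ℝ (⊤ : ℕ∞) (fun x => fderiv ℝ Ψ x (Z x)) M :=
    (hΨsmooth.fderiv_of_isOpen hMopen (by simp)).clm_apply hZsmooth
  have hGY (x) (hx : x ∈ M) (i) : fderiv ℝ (fun z => fderiv ℝ Ψ z (Z z)) x (Y i x) = 0 := by
    refine fderiv_fderiv_apply_eq_zero_of_lieBracket hMopen (hΨsmooth.of_le htwo) hx
      (hdiff (hYsmooth i) x hx) (hdiff hZsmooth x hx) (hΨY i) ?_
    obtain ⟨lam, -, hlam⟩ := hZbr i
    rw [← vfBracket_eq_lieBracket (hdiff hZsmooth x hx) (hdiff (hYsmooth i) x hx), hlam x hx]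
    simp [hΨY _ x hx]
  obtain ⟨Z', hZ', hZ'Ψ⟩ := exists_contDiffOn_eq_comp hne hMopen hΨsmooth hG
    (fun x hx => LinearMap.range_eq_top.mpr fun w => by
      obtain ⟨v, hv⟩ := hΨsubm x hx w
      exact ⟨v, (hpd x hx v).symm.trans hv⟩)
    (fun y hy => (hfib y (hΨim ▸ hy)).isPreconnected)
    (fun x hx v hv => by
      have hle : Submodule.span ℝ (Set.range fun i => Y i x) ≤
          (fderiv ℝ (fun z => fderiv ℝ Ψ z (Z z)) x).ker :=
        Submodule.span_le.mpr (by rintro _ ⟨i, rfl⟩; exact hGY x hx i)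
      exact hle ((hker' x hx v).mpr hv))
  refine ⟨Z', hΨim ▸ hZ', fun x hx i => ?_, fun W _ hW y hy => ?_⟩
  · rw [← hZ'Ψ x hx, ← hpd x hx]
  · obtain ⟨x, hx, rfl⟩ := hΨim.symm ▸ hy
    rw [← hZ'Ψ x hx, ← hpd x hx]
    exact (funext (hW x hx)).symm
end
end

section
/- Let M ⊆ ℝ^n be a connected open set and let 𝒢 be a solvable r-dimensional Lie algebra of smooth vector fields on M (with the usual Lie bracket of vector fields) such that {Y(x) : Y ∈ 𝒢} is an r-dimensional subspace of ℝ^n for every x ∈ M, and let Ψ: M → M' be a reduction map with ker ∇Ψ(x) = {Y(x) : Y ∈ 𝒢} for all x ∈ M. Then for every x₀ ∈ M there exist a basis Y_1,…,Y_r of 𝒢, an open neighborhood U of x₀, and a diffeomorphism Φ: U → M̃ onto an open set M̃ ⊆ ℝ^n whose last n−r components coincide with Ψ (i.e., Φ = (Φ̃, Ψ|_U)^T), such that the push-forwards Φ_*(Y_1),…,Φ_*(Y_r), where Φ_*(Y) = (∇Φ · Y) ∘ Φ^{-1}, are in canonical form on M̃. -/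
noncomputable section

open scoped BigOperators

/-- Derived series of the (abstract) Lie algebra `ℝ^r` determined by structure constants `c`:
`D 0 = ⊤`, `D (N+1) = span of brackets of elements of D N`. -/
def derivedSeriesOfConsts {r : ℕ} (c : Fin r → Fin r → Fin r → ℝ) :
    ℕ → Submodule ℝ (Fin r → ℝ)
  | 0 => ⊤
  | (N + 1) => Submodule.span ℝ
      {w | ∃ u ∈ derivedSeriesOfConsts c N, ∃ v ∈ derivedSeriesOfConsts c N,
        w = fun l => ∑ i, ∑ j, u i * v j * c i j l}

/-- The structure constants `c` give a solvable Lie algebra. -/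
def SolvableConsts {r : ℕ} (c : Fin r → Fin r → Fin r → ℝ) : Prop :=
  ∃ N, derivedSeriesOfConsts c N = ⊥

/-- The vector fields `Y_1,…,Y_r` are in canonical form on `U`: the `n × r` matrix
`(Y_1|…|Y_r)` has a block-triangular structure with identity blocks `I_{i_1},…,I_{i_l}` on the
block diagonal, zero blocks below it, and zeros in the last `n - r` rows.  The blocks are
recorded by the strictly increasing sequence of partial sums `s 0 = 0 < s 1 < … < s l = r`. -/
def IsCanonicalForm {n r : ℕ} (hrn : r ≤ n)
    (Y : Fin r → (Fin n → ℝ) → Fin n → ℝ) (U : Set (Fin n → ℝ)) : Prop :=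
  ∃ (l : ℕ) (s : Fin (l + 1) → ℕ), StrictMono s ∧ s 0 = 0 ∧ s (Fin.last l) = r ∧
    (∀ x ∈ U, ∀ j : Fin r, ∀ i : Fin n, r ≤ (i : ℕ) → Y j x i = 0) ∧
    (∀ x ∈ U, ∀ t : Fin l, ∀ i j : Fin r,
      s t.castSucc ≤ (i : ℕ) → (i : ℕ) < s t.succ →
      s t.castSucc ≤ (j : ℕ) → (j : ℕ) < s t.succ →
      Y j x (Fin.castLE hrn i) = if (i : ℕ) = (j : ℕ) then 1 else 0) ∧
    (∀ x ∈ U, ∀ t t' : Fin l, t' < t → ∀ i j : Fin r,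
      s t.castSucc ≤ (i : ℕ) → (i : ℕ) < s t.succ →
      s t'.castSucc ≤ (j : ℕ) → (j : ℕ) < s t'.succ →
      Y j x (Fin.castLE hrn i) = 0)

section

open Set Topology
open scoped ContDiff

theorem hasFDerivAt_intervalIntegral_of_contDiffOn {E G : Type*} [NormedAddCommGroup E]
    [NormedSpace ℝ E] [FiniteDimensional ℝ E] [NormedAddCommGroup G] [NormedSpace ℝ G]
    {V : Set E} {W : Set (E × ℝ)} (hV : IsOpen V) (hW : IsOpen W)
    (hVW : ∀ x ∈ V, ∀ t ∈ Icc (0 : ℝ) 1, (x, t) ∈ W) {g : E × ℝ → G} (hg : ContDiffOn ℝ 1 g W)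
    {x : E} (hx : x ∈ V) :
    HasFDerivAt (fun x => ∫ t in (0 : ℝ)..1, g (x, t))
      (∫ t in (0 : ℝ)..1, (fderiv ℝ g (x, t)).comp (ContinuousLinearMap.inl ℝ E ℝ)) x := by
  obtain ⟨ε, hε, hball⟩ := Metric.nhds_basis_closedBall.mem_iff.1 (hV.mem_nhds hx)
  have hcont : ContinuousOn (fun z : E × ℝ =>
      (fderiv ℝ g z).comp (ContinuousLinearMap.inl ℝ E ℝ)) W :=
    (hg.continuousOn_fderiv_of_isOpen hW le_rfl).clm_comp continuousOn_const
  obtain ⟨C, hC⟩ := ((isCompact_closedBall x ε).prod (isCompact_Icc (a := (0 : ℝ)) (b := 1)))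
    |>.exists_bound_of_continuousOn (hcont.mono fun z hz => hVW _ (hball hz.1) _ hz.2)
  have hI : Set.uIoc (0 : ℝ) 1 ⊆ Icc 0 1 := by
    rw [uIoc_of_le zero_le_one]; exact Ioc_subset_Icc_self
  have slice : ∀ {H : Type _} [NormedAddCommGroup H] {h : E × ℝ → H}, ContinuousOn h W → ∀ y ∈ V,
      ContinuousOn (fun t => h (y, t)) (Icc 0 1) := fun hh y hy =>
    hh.comp (by fun_prop) fun t ht => hVW y hy t ht
  refine intervalIntegral.hasFDerivAt_integral_of_dominated_of_fderiv_le
    (F' := fun y t => (fderiv ℝ g (y, t)).comp (ContinuousLinearMap.inl ℝ E ℝ))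
    (bound := fun _ => C) (Metric.closedBall_mem_nhds x hε) ?_ ?_ ?_ ?_ ?_ ?_
  · filter_upwards [hV.mem_nhds hx] with y hy
    exact ((slice hg.continuousOn y hy).mono hI).aestronglyMeasurable measurableSet_uIoc
  · exact ContinuousOn.intervalIntegrable (by
      rw [uIcc_of_le zero_le_one]; exact slice hg.continuousOn x hx)
  · refine ContinuousOn.aestronglyMeasurable ?_ measurableSet_uIoc
    exact ((hcont.comp (f := fun t : ℝ => (x, t)) (by fun_prop)
      fun t ht => hVW x hx t ht)).mono hI
  · exact .of_forall fun t ht y hy => hC (y, t) ⟨hy, hI ht⟩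
  · exact intervalIntegrable_const
  · refine .of_forall fun t ht y hy => ?_
    have h1 : HasFDerivAt g (fderiv ℝ g (y, t)) (y, t) :=
      ((hg.differentiableOn one_ne_zero).differentiableAt
        (hW.mem_nhds (hVW y (hball hy) t (hI ht)))).hasFDerivAt
    exact h1.comp y (hasFDerivAt_prodMk_left y t)

theorem contDiffOn_intervalIntegral {E : Type} [NormedAddCommGroup E] [NormedSpace ℝ E]
    [FiniteDimensional ℝ E] {V : Set E} {W : Set (E × ℝ)} (hV : IsOpen V) (hW : IsOpen W)
    (hVW : ∀ x ∈ V, ∀ t ∈ Icc (0 : ℝ) 1, (x, t) ∈ W) {G : Type} [NormedAddCommGroup G]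
    [NormedSpace ℝ G] {g : E × ℝ → G} (hg : ContDiffOn ℝ ∞ g W) :
    ContDiffOn ℝ ∞ (fun x => ∫ t in (0 : ℝ)..1, g (x, t)) V := by
  refine contDiffOn_infty.2 fun n => ?_
  induction n generalizing G with
  | zero =>
    exact contDiffOn_zero.2 fun x hx => (hasFDerivAt_intervalIntegral_of_contDiffOn hV hW hVW
      (hg.of_le (by norm_cast)) hx).continuousAt.continuousWithinAt
  | succ n ih =>
    have hd := fun x (hx : x ∈ V) => hasFDerivAt_intervalIntegral_of_contDiffOn hV hW hVW
      (hg.of_le (by norm_cast)) hx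
    push_cast
    rw [contDiffOn_succ_iff_fderiv_of_isOpen hV]
    refine ⟨fun x hx => (hd x hx).differentiableAt.differentiableWithinAt, by simp, ?_⟩
    refine (ih ((hg.fderiv_of_isOpen hW (m := ∞) (by simp)).clm_comp
      (contDiffOn_const (c := ContinuousLinearMap.inl ℝ E ℝ)))).congr fun x hx => (hd x hx).fderiv

theorem exists_partial_primitive {K F : Type} [NormedAddCommGroup K] [NormedSpace ℝ K]
    [FiniteDimensional ℝ K] [NormedAddCommGroup F] [NormedSpace ℝ F] [FiniteDimensional ℝ F]
    {V₁ : Set K} {V₂ : Set F} (hV₁ : IsOpen V₁) (hconv : Convex ℝ V₁) (hV₂ : IsOpen V₂)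
    {u₀ : K} (hu₀ : u₀ ∈ V₁) {β : K × F → K →L[ℝ] ℝ} (hβ : ContDiffOn ℝ ∞ β (V₁ ×ˢ V₂))
    (hsymm : ∀ z ∈ V₁ ×ˢ V₂, ∀ v w, fderiv ℝ β z (v, 0) w = fderiv ℝ β z (w, 0) v) :
    ∃ f : K × F → ℝ, ContDiffOn ℝ ∞ f (V₁ ×ˢ V₂) ∧
      ∀ z ∈ V₁ ×ˢ V₂, ∀ v, fderiv ℝ f z (v, 0) = β z v := by
  have hV := hV₁.prod hV₂
  let γ : (K × F) × ℝ → K × F := fun q => (AffineMap.lineMap u₀ q.1.1 q.2, q.1.2)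
  have hγ : ContDiff ℝ ∞ γ := by
    simp only [γ, AffineMap.lineMap_apply_module']
    fun_prop
  have hsmooth : ContDiffOn ℝ ∞
      (fun z : K × F => ∫ t in (0 : ℝ)..1, β (γ (z, t)) (z.1 - u₀)) (V₁ ×ˢ V₂) := by
    refine contDiffOn_intervalIntegral (W := γ ⁻¹' (V₁ ×ˢ V₂))
      (g := fun q => β (γ q) (q.1.1 - u₀)) hV (hV.preimage hγ.continuous) ?_ ?_
    · exact fun z hz t ht => ⟨hconv.lineMap_mem hu₀ hz.1 ht, hz.2⟩
    · exact (hβ.comp hγ.contDiffOn fun _ h => h).clm_apply (by fun_prop)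
  refine ⟨_, hsmooth, fun z hz v => ?_⟩
  have hβd : ∀ y ∈ V₁, HasFDerivAt (fun y => β (y, z.2))
      ((fderiv ℝ β (y, z.2)).comp (ContinuousLinearMap.inl ℝ K F)) y := fun y hy =>
    (((hβ.differentiableOn (by simp)).differentiableAt
      (hV.mem_nhds (show (y, z.2) ∈ V₁ ×ˢ V₂ from ⟨hy, hz.2⟩))).hasFDerivAt).comp y (hasFDerivAt_prodMk_left y z.2)
  have h1 := (hconv.hasFDerivWithinAt_curveIntegral_segment_of_hasFDerivWithinAt_symmetric
    (fun y hy => (hβd y hy).hasFDerivWithinAt)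
    (fun y hy v _ w _ => hsymm (y, z.2) ⟨hy, hz.2⟩ v w) hu₀ hz.1).hasFDerivAt (hV₁.mem_nhds hz.1)
  simp only [curveIntegral_segment] at h1
  have h2 := ((hsmooth.differentiableOn (by simp)).differentiableAt
    (hV.mem_nhds hz)).hasFDerivAt.comp (f := fun y => (y, z.2)) z.1 (hasFDerivAt_prodMk_left z.1 z.2)
  exact congrArg (fun L => L v) (h2.unique h1)

theorem exists_openPartialHomeomorph_of_injective_fderiv {E F : Type*} [NormedAddCommGroup E]
    [NormedSpace ℝ E] [FiniteDimensional ℝ E] [NormedAddCommGroup F] [NormedSpace ℝ F]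
    [FiniteDimensional ℝ F] (hdim : Module.finrank ℝ E = Module.finrank ℝ F) {M : Set E}
    (hM : IsOpen M) {x₀ : E} (hx₀ : x₀ ∈ M) {f : E → F} (hf : ContDiffOn ℝ ∞ f M)
    (hinj : ∀ v, fderiv ℝ f x₀ v = 0 → v = 0) :
    ∃ e : OpenPartialHomeomorph E F, x₀ ∈ e.source ∧ e.source ⊆ M ∧ ⇑e = f ∧
      ContDiffOn ℝ ∞ e.symm e.target := by
  have : CompleteSpace E := FiniteDimensional.complete ℝ E
  have hinj' : Function.Injective (fderiv ℝ f x₀ : E →ₗ[ℝ] F) :=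
    (injective_iff_map_eq_zero _).2 hinj
  let A : E ≃L[ℝ] F :=
    (LinearEquiv.ofInjectiveOfFinrankEq (fderiv ℝ f x₀ : E →ₗ[ℝ] F) hinj'
      hdim).toContinuousLinearEquiv
  have hA : (A : E →L[ℝ] F) = fderiv ℝ f x₀ := by ext v; rfl
  have hf₀ : ContDiffAt ℝ ∞ f x₀ := hf.contDiffAt (hM.mem_nhds hx₀)
  have hd₀ : HasFDerivAt f (A : E →L[ℝ] F) x₀ := by
    rw [hA]; exact (hf₀.differentiableAt (by simp)).hasFDerivAt
  let e₁ := hf₀.toOpenPartialHomeomorph f hd₀ (by simp)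
  let S : Set E := M ∩ fderiv ℝ f ⁻¹' range ((↑) : (E ≃L[ℝ] F) → E →L[ℝ] F)
  have hS : IsOpen S := (hf.continuousOn_fderiv_of_isOpen hM (by simp)).isOpen_inter_preimage hM
    ContinuousLinearEquiv.isOpen
  refine ⟨e₁.restrOpen S hS, ⟨hf₀.mem_toOpenPartialHomeomorph_source hd₀ (by simp),
    hx₀, A, hA⟩, fun x hx => hx.2.1, rfl, fun y hy => ?_⟩
  have hy' := (e₁.restrOpen S hS).map_target hy
  obtain ⟨hyM, B, hB⟩ : (e₁.restrOpen S hS).symm y ∈ S := hy'.2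
  have hfy := hf.contDiffAt (hM.mem_nhds hyM)
  refine ((e₁.restrOpen S hS).contDiffAt_symm hy (f₀' := B) ?_ hfy).contDiffWithinAt
  rw [hB]
  exact (hfy.differentiableAt (by simp)).hasFDerivAt

theorem exists_primitive_along_fibers {E F : Type} [NormedAddCommGroup E] [NormedSpace ℝ E]
    [FiniteDimensional ℝ E] [NormedAddCommGroup F] [NormedSpace ℝ F] [FiniteDimensional ℝ F]
    {M : Set E} (hM : IsOpen M) {x₀ : E} (hx₀ : x₀ ∈ M) {Ψ : E → F} (hΨ : ContDiffOn ℝ ∞ Ψ M)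
    (hdim : Module.finrank ℝ E
      = Module.finrank ℝ (fderiv ℝ Ψ x₀ : E →ₗ[ℝ] F).ker + Module.finrank ℝ F)
    {α : E → E →L[ℝ] ℝ} (hα : ContDiffOn ℝ ∞ α M)
    (hsymm : ∀ x ∈ M, ∀ v w, fderiv ℝ Ψ x v = 0 → fderiv ℝ Ψ x w = 0 →
      fderiv ℝ α x v w = fderiv ℝ α x w v) :
    ∃ U : Set E, IsOpen U ∧ x₀ ∈ U ∧ U ⊆ M ∧ ∃ φ : E → ℝ, ContDiffOn ℝ ∞ φ U ∧
      ∀ x ∈ U, ∀ v, fderiv ℝ Ψ x v = 0 → fderiv ℝ φ x v = α x v := by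
  let K := (fderiv ℝ Ψ x₀ : E →ₗ[ℝ] F).ker
  obtain ⟨π, hπ⟩ := K.subtype.exists_leftInverse_of_injective K.ker_subtype
  let P : E →L[ℝ] K := LinearMap.toContinuousLinearMap π
  have hP : ∀ v : K, P v = v := fun v => congrArg (fun L => L v) hπ
  let G : E → K × F := fun x => (P x, Ψ x)
  have hG : ContDiffOn ℝ ∞ G M := P.contDiff.contDiffOn.prodMk hΨ
  have hΨd : ∀ x ∈ M, HasFDerivAt Ψ (fderiv ℝ Ψ x) x := fun x hx =>
    ((hΨ.differentiableOn (by simp)).differentiableAt (hM.mem_nhds hx)).hasFDerivAt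
  have hGd : ∀ x ∈ M, HasFDerivAt G (P.prod (fderiv ℝ Ψ x)) x := fun x hx =>
    P.hasFDerivAt.prodMk (hΨd x hx)
  obtain ⟨e, hxe, heM, heG, he⟩ := exists_openPartialHomeomorph_of_injective_fderiv
    (by rw [hdim, Module.finrank_prod]) hM hx₀ hG (by
      intro v hv
      rw [(hGd x₀ hx₀).fderiv] at hv
      have h1 : P v = 0 := congrArg Prod.fst hv
      have h2 : fderiv ℝ Ψ x₀ v = 0 := congrArg Prod.snd hv
      have h3 := hP ⟨v, h2⟩
      rw [h1] at h3
      exact (congrArg Subtype.val h3).symm)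
  obtain ⟨ε, hε, hball⟩ := Metric.isOpen_iff.1 e.open_target (e x₀) (e.map_source hxe)
  rw [← Prod.mk.eta (p := e x₀), ← ball_prod_same] at hball
  set V₁ := Metric.ball (e x₀).1 ε
  set V₂ := Metric.ball (e x₀).2 ε
  have hV : IsOpen (V₁ ×ˢ V₂) := Metric.isOpen_ball.prod Metric.isOpen_ball
  let H := e.symm
  have hH : ∀ z ∈ e.target, HasFDerivAt H (fderiv ℝ H z) z := fun z hz =>
    ((he.differentiableOn (by simp)).differentiableAt (e.open_target.mem_nhds hz)).hasFDerivAt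
  have hHM : ∀ z ∈ e.target, H z ∈ M := fun z hz => heM (e.map_target hz)
  have hDH : ContDiffOn ℝ ∞ (fderiv ℝ H) e.target :=
    he.fderiv_of_isOpen e.open_target (by simp)
  have hαH : ContDiffOn ℝ ∞ (fun z => α (H z)) e.target := hα.comp he hHM
  have hker : ∀ z ∈ e.target, ∀ v : K, fderiv ℝ Ψ (H z) (fderiv ℝ H z (v, 0)) = 0 := by
    intro z hz v
    have h1 := (hΨd _ (hHM z hz)).comp z (hH z hz)
    have h2 : HasFDerivAt (Ψ ∘ H) (ContinuousLinearMap.snd ℝ K F) z := by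
      refine hasFDerivAt_snd.congr_of_eventuallyEq ?_
      filter_upwards [e.open_target.mem_nhds hz] with y hy
      have h3 : G (H y) = y := by rw [← heG]; exact e.right_inv hy
      exact congrArg Prod.snd h3
    simpa using congrArg (fun L => L (v, 0)) (h1.unique h2)
  let β : K × F → K →L[ℝ] ℝ := fun z =>
    (α (H z)).comp ((fderiv ℝ H z).comp (ContinuousLinearMap.inl ℝ K F))
  have hβ : ContDiffOn ℝ ∞ β e.target := hαH.clm_comp (hDH.clm_comp contDiffOn_const)
  have hβd : ∀ z ∈ e.target, ∀ v w : K, fderiv ℝ β z (v, 0) w =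
      α (H z) (fderiv ℝ (fderiv ℝ H) z (v, 0) (w, 0)) +
        fderiv ℝ α (H z) (fderiv ℝ H z (v, 0)) (fderiv ℝ H z (w, 0)) := by
    intro z hz v w
    have hz' := e.open_target.mem_nhds hz
    have h1 := ((hβ.differentiableOn (by simp)).differentiableAt hz').hasFDerivAt.clm_apply
      (hasFDerivAt_const w z)
    have h2 := (((hα.differentiableOn (by simp)).differentiableAt
      (hM.mem_nhds (hHM z hz))).hasFDerivAt.comp z (hH z hz)).clm_apply
      (((hDH.differentiableOn (by simp)).differentiableAt hz').hasFDerivAt.clm_apply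
        (hasFDerivAt_const ((w, 0) : K × F) z))
    simpa using congrArg (fun L => L (v, 0)) (h1.unique h2)
  obtain ⟨f, hf, hfβ⟩ := exists_partial_primitive Metric.isOpen_ball (convex_ball _ _)
    Metric.isOpen_ball (Metric.mem_ball_self hε) (hβ.mono hball) (by
      intro z hz v w
      have hz' := hball hz
      rw [hβd z hz', hβd z hz', hsymm _ (hHM z hz') _ _ (hker z hz' v) (hker z hz' w)]
      congr 2
      exact (he.contDiffAt (e.open_target.mem_nhds hz')).isSymmSndFDerivAt
        (by simp; norm_cast) (v, 0) (w, 0))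
  refine ⟨e.source ∩ e ⁻¹' (V₁ ×ˢ V₂), e.isOpen_inter_preimage hV,
    ⟨hxe, Metric.mem_ball_self hε, Metric.mem_ball_self hε⟩, fun x hx => heM hx.1,
    f ∘ G, hf.comp (hG.mono fun x hx => heM hx.1) fun x hx => by rw [← heG]; exact hx.2,
    fun x hx v hv => ?_⟩
  have hxV : G x ∈ V₁ ×ˢ V₂ := by rw [← heG]; exact hx.2
  have hHG : H (G x) = x := by rw [← heG]; exact e.left_inv hx.1
  have hGx := hGd x (heM hx.1)
  have h1 := ((hf.differentiableOn (by simp)).differentiableAt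
    (hV.mem_nhds hxV)).hasFDerivAt.comp x hGx
  have h2 : HasFDerivAt (H ∘ G) (ContinuousLinearMap.id ℝ E) x := by
    refine (hasFDerivAt_id x).congr_of_eventuallyEq ?_
    filter_upwards [e.open_source.mem_nhds hx.1] with y hy
    simpa [← heG] using e.left_inv hy
  have h3 := congrArg (fun L => L v) (((hH _ (hball hxV)).comp x hGx).unique h2)
  simp only [ContinuousLinearMap.comp_apply, ContinuousLinearMap.prod_apply, hv,
    ContinuousLinearMap.id_apply] at h3
  rw [h1.fderiv, ContinuousLinearMap.comp_apply, ContinuousLinearMap.prod_apply, hv,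
    hfβ _ hxV]
  simp only [β, ContinuousLinearMap.comp_apply, ContinuousLinearMap.inl_apply, h3, hHG]

theorem exists_dual_coframe {E : Type*} [NormedAddCommGroup E] [NormedSpace ℝ E]
    [FiniteDimensional ℝ E] {r : ℕ} {M : Set E} (hM : IsOpen M) {x₀ : E} (hx₀ : x₀ ∈ M)
    {Y : Fin r → E → E} (hY : ∀ i, ContDiffOn ℝ ∞ (Y i) M)
    (hli : LinearIndependent ℝ fun i => Y i x₀) :
    ∃ U : Set E, IsOpen U ∧ x₀ ∈ U ∧ U ⊆ M ∧ ∃ α : Fin r → E → E →L[ℝ] ℝ,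
      (∀ i, ContDiffOn ℝ ∞ (α i) U) ∧
      ∀ x ∈ U, ∀ i j, α i x (Y j x) = if i = j then 1 else 0 := by
  let L : E → (Fin r → ℝ) →L[ℝ] E := fun x =>
    ∑ j, (ContinuousLinearMap.proj (R := ℝ) (φ := fun _ : Fin r => ℝ) j).smulRight (Y j x)
  have hL : ∀ x a, L x a = ∑ j, a j • Y j x := fun x a => by simp [L]
  have hLs : ∀ x j, L x (Pi.single j 1) = Y j x := fun x j => by
    simp [hL, Pi.single_apply]
  have hLsmooth : ContDiffOn ℝ ∞ L M :=
    ContDiffOn.sum fun j _ => contDiffOn_const.smulRight (hY j)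
  have hLinj : (L x₀ : (Fin r → ℝ) →ₗ[ℝ] E).ker = ⊥ := by
    refine LinearMap.ker_eq_bot'.2 fun a ha => ?_
    exact funext (Fintype.linearIndependent_iff.1 hli a ((hL x₀ a).symm.trans ha))
  obtain ⟨p, hp⟩ := LinearMap.exists_leftInverse_of_injective _ hLinj
  let P : E →L[ℝ] (Fin r → ℝ) := LinearMap.toContinuousLinearMap p
  let T : E → (Fin r → ℝ) →L[ℝ] (Fin r → ℝ) := fun x => P.comp (L x)
  have hT : ContDiffOn ℝ ∞ T M := contDiffOn_const.clm_comp hLsmooth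
  have hT₀ : T x₀ = ContinuousLinearMap.id ℝ _ :=
    ContinuousLinearMap.ext fun a => congrArg (fun l => l a) hp
  let U : Set E := M ∩ T ⁻¹'
    range ((↑) : ((Fin r → ℝ) ≃L[ℝ] (Fin r → ℝ)) → (Fin r → ℝ) →L[ℝ] (Fin r → ℝ))
  refine ⟨U, hT.continuousOn.isOpen_inter_preimage hM ContinuousLinearEquiv.isOpen,
    ⟨hx₀, ContinuousLinearEquiv.refl ℝ _, hT₀.symm⟩, inter_subset_left,
    fun i x => (ContinuousLinearMap.proj i).comp ((T x).inverse.comp P), fun i => ?_, ?_⟩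
  · refine contDiffOn_const.clm_comp (ContDiffOn.clm_comp ?_ contDiffOn_const)
    rintro x ⟨hx, B, hB⟩
    refine ContDiffAt.comp_contDiffWithinAt (g := ContinuousLinearMap.inverse) x ?_ ((hT x hx).mono inter_subset_left)
    rw [← hB]
    exact contDiffAt_map_inverse (𝕜 := ℝ) B
  · rintro x ⟨hx, B, hB⟩ i j
    have h : P (Y j x) = B (Pi.single j 1) := by
      rw [← hLs]; exact congrArg (fun l => l (Pi.single j 1)) hB.symm
    simp only [ContinuousLinearMap.comp_apply, h]
    rw [← hB, ContinuousLinearMap.inverse_equiv]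
    simp [Pi.single_apply]

theorem coeff_eq_zero_of_triangular {E : Type*} [AddCommGroup E] [Module ℝ E] {r : ℕ}
    {y : Fin r → E} {lam : Fin r → E →ₗ[ℝ] ℝ} {k : ℕ}
    (hdiag : ∀ i : Fin r, k ≤ i → lam i (y i) = 1)
    (hlow : ∀ i : Fin r, k ≤ i → ∀ j < i, lam i (y j) = 0)
    {a : Fin r → ℝ} (ha : ∀ i : Fin r, k ≤ i → lam i (∑ j, a j • y j) = 0) :
    ∀ i : Fin r, k ≤ i → a i = 0 := by
  intro i
  induction i using WellFoundedGT.induction with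
  | ind i ih =>
    intro hi
    have h := ha i hi
    rw [map_sum, Finset.sum_eq_single i] at h
    · simpa [hdiag i hi] using h
    · intro j _ hj
      rcases lt_or_gt_of_ne hj with hj | hj
      · simp [hlow i hi j hj]
      · simp [ih j hj (hi.trans hj.le)]
    · simp

theorem mem_span_of_triangular {E : Type*} [AddCommGroup E] [Module ℝ E] {r : ℕ}
    {y : Fin r → E} {lam : Fin r → E →ₗ[ℝ] ℝ} {k : ℕ}
    (hdiag : ∀ i : Fin r, k ≤ i → lam i (y i) = 1)
    (hlow : ∀ i : Fin r, k ≤ i → ∀ j < i, lam i (y j) = 0)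
    {v : E} (hv : v ∈ Submodule.span ℝ (range y)) (hv0 : ∀ i : Fin r, k ≤ i → lam i v = 0) :
    v ∈ Submodule.span ℝ (y '' {j : Fin r | (j : ℕ) < k}) := by
  obtain ⟨a, rfl⟩ := (Submodule.mem_span_range_iff_exists_fun ℝ).1 hv
  have ha := coeff_eq_zero_of_triangular hdiag hlow hv0
  refine Submodule.sum_mem _ fun j _ => ?_
  by_cases hj : (j : ℕ) < k
  · exact Submodule.smul_mem _ _ (Submodule.subset_span ⟨j, hj, rfl⟩)
  · simp [ha j (not_lt.1 hj)]

theorem fderiv_coframe_symm {E : Type*} [NormedAddCommGroup E] [NormedSpace ℝ E]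
    {r : ℕ} {U : Set E} (hU : IsOpen U) {Y : Fin r → E → E}
    (hY : ∀ i, DifferentiableOn ℝ (Y i) U) {α : E → E →L[ℝ] ℝ} (hα : DifferentiableOn ℝ α U)
    {m : Fin r} (hαY : ∀ x ∈ U, ∀ j, α x (Y j x) = if m = j then 1 else 0)
    (hbr : ∀ x ∈ U, ∀ i j, i ≤ m → j ≤ m →
      fderiv ℝ (Y j) x (Y i x) - fderiv ℝ (Y i) x (Y j x) ∈
        Submodule.span ℝ ((fun l => Y l x) '' {l | l < m}))
    {x : E} (hx : x ∈ U) {v w : E}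
    (hv : v ∈ Submodule.span ℝ ((fun l => Y l x) '' {l | l ≤ m}))
    (hw : w ∈ Submodule.span ℝ ((fun l => Y l x) '' {l | l ≤ m})) :
    fderiv ℝ α x v w = fderiv ℝ α x w v := by
  have hUx := hU.mem_nhds hx
  have hd : ∀ i j, α x (fderiv ℝ (Y j) x (Y i x)) + fderiv ℝ α x (Y i x) (Y j x) = 0 := by
    intro i j
    have h1 := ((hα.differentiableAt hUx).hasFDerivAt).clm_apply
      ((hY j).differentiableAt hUx).hasFDerivAt
    have h2 : HasFDerivAt (fun x => α x (Y j x)) (0 : E →L[ℝ] ℝ) x := by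
      refine (hasFDerivAt_const (if m = j then (1 : ℝ) else 0) x).congr_of_eventuallyEq ?_
      filter_upwards [hUx] with y hy using hαY y hy j
    simpa using congrArg (fun L => L (Y i x)) (h1.unique h2)
  have h0 : ∀ u ∈ Submodule.span ℝ ((fun l => Y l x) '' {l | l < m}), α x u = 0 := by
    intro u hu
    have : Submodule.span ℝ ((fun l => Y l x) '' {l | l < m}) ≤ (α x : E →ₗ[ℝ] ℝ).ker := by
      rw [Submodule.span_le]
      rintro _ ⟨l, hl, rfl⟩
      simpa [(show l < m from hl).ne'] using hαY x hx l
    exact this hu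
  have hbase : ∀ i j, i ≤ m → j ≤ m →
      fderiv ℝ α x (Y i x) (Y j x) = fderiv ℝ α x (Y j x) (Y i x) := by
    intro i j hi hj
    have h1 := h0 _ (hbr x hx i j hi hj)
    rw [map_sub] at h1
    linarith [hd i j, hd j i]
  induction hv using Submodule.span_induction with
  | mem v hv =>
    obtain ⟨i, hi, rfl⟩ := hv
    induction hw using Submodule.span_induction with
    | mem w hw => obtain ⟨j, hj, rfl⟩ := hw; exact hbase i j hi hj
    | zero => simp
    | add a b _ _ ha hb => simp_all
    | smul c a _ ha => simp_all
  | zero => simp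
  | add a b _ _ ha hb => simp_all
  | smul c a _ ha => simp_all

theorem exists_triangular_functions {E F : Type} [NormedAddCommGroup E] [NormedSpace ℝ E]
    [FiniteDimensional ℝ E] [NormedAddCommGroup F] [NormedSpace ℝ F] [FiniteDimensional ℝ F]
    {r : ℕ} {M : Set E} (hM : IsOpen M) {x₀ : E} (hx₀ : x₀ ∈ M)
    {Y : Fin r → E → E} (hY : ∀ i, ContDiffOn ℝ ∞ (Y i) M)
    (hli : ∀ x ∈ M, LinearIndependent ℝ fun i => Y i x)
    (hbr : ∀ x ∈ M, ∀ m i j, i ≤ m → j ≤ m →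
      fderiv ℝ (Y j) x (Y i x) - fderiv ℝ (Y i) x (Y j x) ∈
        Submodule.span ℝ ((fun l => Y l x) '' {l | l < m}))
    {Ψ : E → F} (hΨ : ContDiffOn ℝ ∞ Ψ M)
    (hdim : Module.finrank ℝ E = r + Module.finrank ℝ F)
    (hker : ∀ x ∈ M, ∀ v, fderiv ℝ Ψ x v = 0 ↔ v ∈ Submodule.span ℝ (range fun i => Y i x)) :
    ∃ U : Set E, IsOpen U ∧ x₀ ∈ U ∧ U ⊆ M ∧ ∃ φ : Fin r → E → ℝ,
      (∀ i, ContDiffOn ℝ ∞ (φ i) U) ∧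
      ∀ x ∈ U, ∀ i, fderiv ℝ (φ i) x (Y i x) = 1 ∧ ∀ j < i, fderiv ℝ (φ i) x (Y j x) = 0 := by
  obtain ⟨M₁, hM₁, hx₁, hM₁M, α, hα, hαY⟩ := exists_dual_coframe hM hx₀ hY (hli x₀ hx₀)
  suffices h : ∀ k ≤ r, ∃ U : Set E, IsOpen U ∧ x₀ ∈ U ∧ U ⊆ M₁ ∧ ∃ φ : Fin r → E → ℝ,
      (∀ i, ContDiffOn ℝ ∞ (φ i) U) ∧ ∀ x ∈ U, ∀ i : Fin r, k ≤ i →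
        fderiv ℝ (φ i) x (Y i x) = 1 ∧ ∀ j < i, fderiv ℝ (φ i) x (Y j x) = 0 by
    obtain ⟨U, hU, hxU, hUM, φ, hφ, hφY⟩ := h 0 (Nat.zero_le r)
    exact ⟨U, hU, hxU, hUM.trans hM₁M, φ, hφ, fun x hx i => hφY x hx i (Nat.zero_le _)⟩
  intro k hk
  induction hk using Nat.decreasingInduction with
  | self =>
    exact ⟨M₁, hM₁, hx₁, subset_rfl, fun _ _ => 0, fun _ => contDiffOn_const,
      fun x _ i hi => absurd i.2 (not_lt.2 hi)⟩
  | of_succ k hk ih =>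
    obtain ⟨U, hU, hxU, hUM, φ, hφ, hφY⟩ := ih
    let m : Fin r := ⟨k, hk⟩
    let I := {i : Fin r // m < i}
    let Ψ' : E → F × (I → ℝ) := fun x => (Ψ x, fun i => φ i x)
    have hΨ' : ContDiffOn ℝ ∞ Ψ' U :=
      (hΨ.mono (hUM.trans hM₁M)).prodMk (contDiffOn_pi.2 fun i => hφ i)
    have hφd : ∀ i, ∀ x ∈ U, HasFDerivAt (φ i) (fderiv ℝ (φ i) x) x := fun i x hx =>
      (((hφ i).differentiableOn (by simp)).differentiableAt (hU.mem_nhds hx)).hasFDerivAt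
    have hΨ'd : ∀ x ∈ U, fderiv ℝ Ψ' x =
        (fderiv ℝ Ψ x).prod (ContinuousLinearMap.pi fun i : I => fderiv ℝ (φ i) x) := by
      intro x hx
      have h1 : HasFDerivAt Ψ (fderiv ℝ Ψ x) x := ((hΨ.differentiableOn (by simp)).differentiableAt
        (hM.mem_nhds (hM₁M (hUM hx)))).hasFDerivAt
      exact (h1.prodMk (hasFDerivAt_pi.2 fun i : I => hφd i x hx)).fderiv
    have hker' : ∀ x ∈ U, (fderiv ℝ Ψ' x : E →ₗ[ℝ] F × (I → ℝ)).ker =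
        Submodule.span ℝ ((fun l => Y l x) '' {l | l ≤ m}) := by
      intro x hx
      have hxM := hM₁M (hUM hx)
      have hset : {l : Fin r | l ≤ m} = {l : Fin r | (l : ℕ) < k + 1} := by
        ext l; simp [Fin.le_def, m]
      apply le_antisymm
      · intro v hv
        have hv' : fderiv ℝ Ψ' x v = 0 := hv
        rw [hΨ'd x hx] at hv'
        have h1 : fderiv ℝ Ψ x v = 0 := congrArg Prod.fst hv'
        have h2 : ∀ i : I, fderiv ℝ (φ i) x v = 0 := congrFun (congrArg Prod.snd hv')
        rw [hset]
        exact mem_span_of_triangular (lam := fun i => (fderiv ℝ (φ i) x : E →ₗ[ℝ] ℝ))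
          (fun i hi => (hφY x hx i hi).1) (fun i hi => (hφY x hx i hi).2)
          ((hker x hxM v).1 h1) fun i hi => h2 ⟨i, hi⟩
      · rw [Submodule.span_le]
        rintro _ ⟨l, hl, rfl⟩
        change fderiv ℝ Ψ' x (Y l x) = 0
        rw [hΨ'd x hx]
        refine Prod.ext ((hker x hxM _).2 (Submodule.subset_span ⟨l, rfl⟩)) (funext fun i => ?_)
        exact (hφY x hx i i.2).2 l (lt_of_le_of_lt hl i.2)
    have hdim' : Module.finrank ℝ E = Module.finrank ℝ
        (fderiv ℝ Ψ' x₀ : E →ₗ[ℝ] F × (I → ℝ)).ker + Module.finrank ℝ (F × (I → ℝ)) := by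
      have h1 : Module.finrank ℝ (Submodule.span ℝ ((fun l => Y l x₀) '' {l | l ≤ m})) =
          Fintype.card {l : Fin r // l ≤ m} := by
        rw [image_eq_range]
        exact finrank_span_eq_card ((hli x₀ hx₀).comp _ Subtype.val_injective)
      have h2 : Fintype.card {l : Fin r // l ≤ m} = k + 1 := by
        rw [Fintype.card_of_subtype (Finset.Iic m) (by simp), Fin.card_Iic]
      rw [hker' x₀ hxU, h1, h2, hdim, Module.finrank_prod, Module.finrank_fintype_fun_eq_card]
      have h3 : Fintype.card I = r - 1 - k := by
        rw [Fintype.card_of_subtype (Finset.Ioi m) (by simp), Fin.card_Ioi]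
      omega
    obtain ⟨U', hU', hxU', hU'U, f, hf, hfα⟩ := exists_primitive_along_fibers hU hxU hΨ' hdim'
      ((hα m).mono hUM) (by
        intro x hx v w hv hw
        refine fderiv_coframe_symm hU
          (fun i => ((hY i).mono (hUM.trans hM₁M)).differentiableOn (by simp))
          (((hα m).mono hUM).differentiableOn (by simp)) (m := m)
          (fun y hy j => hαY y (hUM hy) m j)
          (fun y hy i j hi hj => hbr y (hM₁M (hUM hy)) m i j hi hj) hx ?_ ?_
        · rw [← hker' x hx]; exact hv
        · rw [← hker' x hx]; exact hw)
    have hfY : ∀ x ∈ U', ∀ l ≤ m, fderiv ℝ f x (Y l x) = if m = l then 1 else 0 := by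
      intro x hx l hl
      rw [← hαY x (hUM (hU'U hx)) m l]
      refine hfα x hx _ ?_
      change Y l x ∈ (fderiv ℝ Ψ' x : E →ₗ[ℝ] F × (I → ℝ)).ker
      rw [hker' x (hU'U hx)]
      exact Submodule.subset_span ⟨l, hl, rfl⟩
    refine ⟨U', hU', hxU', hU'U.trans hUM, Function.update φ m f, fun i => ?_, fun x hx i hi => ?_⟩
    · rcases eq_or_ne i m with rfl | him
      · simpa using hf
      · simpa [him] using (hφ i).mono hU'U
    · rcases eq_or_ne i m with him | him
      · subst him
        simp only [Function.update_self]
        exact ⟨by simpa using hfY x hx m le_rfl, fun j hj => by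
          simpa [hj.ne'] using hfY x hx j hj.le⟩
      · simp only [Function.update_of_ne him]
        exact hφY x (hU'U hx) i
          (lt_of_le_of_ne hi fun h => him (Fin.ext h.symm))

/-- The span of all values of a binary operation on a submodule. -/
def bracketSpan {V : Type*} [AddCommGroup V] [Module ℝ V] (br : V → V → V)
    (S : Submodule ℝ V) : Submodule ℝ V :=
  Submodule.span ℝ {w | ∃ u ∈ S, ∃ v ∈ S, w = br u v}

theorem bracketSpan_mono {V : Type*} [AddCommGroup V] [Module ℝ V] (br : V → V → V) :
    Monotone (bracketSpan br) := fun _ _ h =>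
  Submodule.span_mono fun _ ⟨u, hu, v, hv, hw⟩ => ⟨u, h hu, v, h hv, hw⟩

theorem exists_triangular_basis {V : Type*} [AddCommGroup V] [Module ℝ V]
    [FiniteDimensional ℝ V] (br : V → V → V) (S : Submodule ℝ V) (hS : bracketSpan br S ≤ S)
    {N : ℕ} (hN : (bracketSpan br)^[N] S = ⊥) :
    ∃ (k : ℕ) (b : Fin k → V), LinearIndependent ℝ b ∧ Submodule.span ℝ (range b) = S ∧
      ∀ m i j, i ≤ m → j ≤ m → br (b i) (b j) ∈ Submodule.span ℝ (b '' {l | l < m}) := by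
  induction hd : Module.finrank ℝ S using Nat.strong_induction_on generalizing S with
  | _ d ih =>
    subst hd
    rcases eq_or_ne S ⊥ with rfl | hS0
    · exact ⟨0, Fin.elim0, linearIndependent_empty_type, by simp, fun m => m.elim0⟩
    have hlt : bracketSpan br S < S := by
      refine lt_of_le_of_ne hS fun h => hS0 ?_
      rw [← hN, Function.iterate_fixed h]
    obtain ⟨v, hvS, hv⟩ := SetLike.exists_of_lt hlt
    obtain ⟨f, hfv, hf⟩ := Submodule.exists_le_ker_of_notMem hv
    have hWS : S ⊓ f.ker < S := lt_of_le_of_ne inf_le_left fun h => hfv (inf_eq_left.1 h hvS)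
    have hSW : bracketSpan br S ≤ S ⊓ f.ker := le_inf hS hf
    obtain ⟨k, b, hb, hspan, hbr⟩ := ih _ (Submodule.finrank_lt_finrank_of_lt hWS) (S ⊓ f.ker)
      ((bracketSpan_mono br hWS.le).trans hSW)
      (le_bot_iff.1 (hN ▸ (bracketSpan_mono br).iterate N hWS.le)) rfl
    have hvW : v ∉ Submodule.span ℝ (range b) := by rw [hspan]; exact fun h => hfv h.2
    have hspan' : Submodule.span ℝ (range (Fin.snoc b v : Fin (k + 1) → V)) = S := by
      rw [Fin.range_snoc, Submodule.span_insert, hspan]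
      refine le_antisymm (sup_le ((Submodule.span_singleton_le_iff_mem _ _).2 hvS) hWS.le) ?_
      intro u hu
      have h1 : u - (f u / f v) • v ∈ S ⊓ f.ker :=
        ⟨S.sub_mem hu (S.smul_mem _ hvS), by simp [hfv]⟩
      rw [← add_sub_cancel ((f u / f v) • v) u]
      exact Submodule.add_mem_sup (Submodule.smul_mem _ _ (Submodule.mem_span_singleton_self v)) h1
    refine ⟨k + 1, Fin.snoc b v, linearIndependent_finSnoc.2 ⟨hb, hvW⟩, hspan', fun m => ?_⟩
    induction m using Fin.lastCases with
    | last =>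
      intro i j _ _
      have hmem : ∀ i, (Fin.snoc b v : Fin (k + 1) → V) i ∈ S := fun i => by
        rw [← hspan']; exact Submodule.subset_span ⟨i, rfl⟩
      have h1 := hSW (Submodule.subset_span ⟨_, hmem i, _, hmem j, rfl⟩)
      rw [← hspan] at h1
      refine Submodule.span_mono ?_ h1
      rintro _ ⟨l, rfl⟩
      exact ⟨l.castSucc, Fin.castSucc_lt_last l, by simp⟩
    | cast m =>
      intro i j hi hj
      obtain ⟨i, rfl⟩ := Fin.exists_castSucc_eq.2 (hi.trans_lt (Fin.castSucc_lt_last m)).ne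
      obtain ⟨j, rfl⟩ := Fin.exists_castSucc_eq.2 (hj.trans_lt (Fin.castSucc_lt_last m)).ne
      simp only [Fin.snoc_castSucc]
      refine Submodule.span_mono ?_ (hbr m i j (by simpa using hi) (by simpa using hj))
      rintro _ ⟨l, hl, rfl⟩
      exact ⟨l.castSucc, Fin.castSucc_lt_castSucc_iff.2 hl, by simp⟩

theorem exists_triangular_basis_of_solvableConsts {r : ℕ} {c : Fin r → Fin r → Fin r → ℝ}
    (hc : SolvableConsts c) :
    ∃ b : Fin r → Fin r → ℝ, LinearIndependent ℝ b ∧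
      ∀ m i j, i ≤ m → j ≤ m →
        (fun l => ∑ a, ∑ a', b i a * b j a' * c a a' l) ∈ Submodule.span ℝ (b '' {l | l < m}) := by
  obtain ⟨N, hN⟩ := hc
  let br : (Fin r → ℝ) → (Fin r → ℝ) → Fin r → ℝ :=
    fun u v l => ∑ a, ∑ a', u a * v a' * c a a' l
  have hD : ∀ N, derivedSeriesOfConsts c N = (bracketSpan br)^[N] ⊤ := by
    intro N
    induction N with
    | zero => rfl
    | succ N ih => rw [Function.iterate_succ_apply', ← ih]; rfl
  obtain ⟨k, b, hb, hspan, hbr⟩ := exists_triangular_basis br ⊤ le_top (hD N ▸ hN)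
  obtain rfl : k = r := by
    have h := finrank_span_eq_card hb
    rw [hspan] at h
    simpa using h.symm
  exact ⟨b, hb, hbr⟩

theorem sum_pd_mul {d : ℕ} (f : (Fin d → ℝ) → ℝ) (x v : Fin d → ℝ) :
    ∑ k, pd f k x * v k = fderiv ℝ f x v := by
  rw [← ContinuousLinearMap.coe_coe, LinearMap.pi_apply_eq_sum_univ]
  refine Finset.sum_congr rfl fun k _ => ?_
  rw [smul_eq_mul, mul_comm, pd, ContinuousLinearMap.coe_coe]
  congr 2
  ext i
  simp [Pi.single_apply, eq_comm]

theorem fderiv_coord {E : Type*} [NormedAddCommGroup E] [NormedSpace ℝ E] {d : ℕ}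
    {f : E → Fin d → ℝ} {x : E} (hf : DifferentiableAt ℝ f x) (v : E) (i : Fin d) :
    fderiv ℝ (fun y => f y i) x v = fderiv ℝ f x v i :=
  congrArg (fun L => L v) (hasFDerivAt_pi'.1 hf.hasFDerivAt i).fderiv

theorem vfBracket_eq {d : ℕ} {X Y : (Fin d → ℝ) → Fin d → ℝ} {x : Fin d → ℝ}
    (hX : DifferentiableAt ℝ X x) (hY : DifferentiableAt ℝ Y x) :
    vfBracket X Y x = fderiv ℝ Y x (X x) - fderiv ℝ X x (Y x) := by
  ext i
  rw [Pi.sub_apply, ← fderiv_coord hY, ← fderiv_coord hX, ← sum_pd_mul, ← sum_pd_mul,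
    ← Finset.sum_sub_distrib]
  exact Finset.sum_congr rfl fun k _ => by ring

theorem fderiv_linearCombination_bracket {E : Type*} [NormedAddCommGroup E] [NormedSpace ℝ E]
    {r : ℕ} {Z : Fin r → E → E} {x : E} (hZ : ∀ i, DifferentiableAt ℝ (Z i) x)
    {c : Fin r → Fin r → Fin r → ℝ}
    (hbr : ∀ i j, fderiv ℝ (Z j) x (Z i x) - fderiv ℝ (Z i) x (Z j x) = ∑ l, c i j l • Z l x)
    (u v : Fin r → ℝ) :
    fderiv ℝ (fun y => ∑ a, v a • Z a y) x (∑ a, u a • Z a x) -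
        fderiv ℝ (fun y => ∑ a, u a • Z a y) x (∑ a, v a • Z a x) =
      ∑ l, (∑ a, ∑ a', u a * v a' * c a a' l) • Z l x := by
  have hd : ∀ w : Fin r → ℝ, fderiv ℝ (fun y => ∑ a, w a • Z a y) x =
      ∑ a, w a • fderiv ℝ (Z a) x := fun w =>
    (HasFDerivAt.fun_sum fun a _ => (hZ a).hasFDerivAt.const_smul (w a)).fderiv
  have h1 : ∀ u v : Fin r → ℝ, fderiv ℝ (fun y => ∑ a, v a • Z a y) x (∑ a, u a • Z a x) =
      ∑ a, ∑ a', (u a * v a') • fderiv ℝ (Z a') x (Z a x) := by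
    intro u v
    rw [hd, map_sum]
    refine Finset.sum_congr rfl fun a _ => ?_
    simp [Finset.smul_sum, mul_smul]
  rw [h1 u v, h1 v u, Finset.sum_comm (f := fun a a' => (v a * u a') • _),
    ← Finset.sum_sub_distrib]
  simp only [← Finset.sum_sub_distrib, mul_comm (v _), ← smul_sub, hbr, Finset.smul_sum, smul_smul,
    Finset.sum_smul]
  symm
  rw [Finset.sum_comm]
  exact Finset.sum_congr rfl fun a _ => Finset.sum_comm

end

/-- Theorem 2.8.  Let `𝒢` be a solvable `r`-dimensional Lie algebra of
smooth vector fields on a connected open set `M ⊆ ℝ^n` (here given through a pointwise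
linearly independent family of generators `Z` with solvable structure constants `c`), whose
pointwise values give `ker ∇Ψ` for a reduction map `Ψ`.  Then near every `x₀ ∈ M` there are a
basis `Y` of `𝒢` and a local diffeomorphism `Φ = (Φ̃, Ψ)ᵀ` such that the push-forwards
`Φ_*(Y_1),…,Φ_*(Y_r)` are in canonical form. -/
theorem solvable_algebra_canonical_coordinates
    {n p r : ℕ} (hrn : r ≤ n) (hp : p = n - r)
    (M : Set (Fin n → ℝ)) (hMopen : IsOpen M) (hMconn : IsConnected M)
    (M' : Set (Fin p → ℝ)) (hM'open : IsOpen M')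
    (Z : Fin r → (Fin n → ℝ) → Fin n → ℝ)
    (hZsmooth : ∀ i, ContDiffOn ℝ (⊤ : ℕ∞) (Z i) M)
    (hZindep : ∀ x ∈ M, LinearIndependent ℝ (fun i => Z i x))
    (c : Fin r → Fin r → Fin r → ℝ)
    (hZbr : ∀ i j, ∀ x ∈ M, vfBracket (Z i) (Z j) x = ∑ l, c i j l • Z l x)
    (hsolv : SolvableConsts c)
    (Ψ : (Fin n → ℝ) → Fin p → ℝ)
    (hΨsmooth : ContDiffOn ℝ (⊤ : ℕ∞) Ψ M)
    (hΨim : Ψ '' M = M')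
    (hΨsubm : ∀ x ∈ M, Function.Surjective
      (fun v : Fin n → ℝ => (fun i => ∑ j, pd (fun y => Ψ y i) j x * v j : Fin p → ℝ)))
    (hfib : ∀ y ∈ M', IsConnected {x ∈ M | Ψ x = y})
    (hker : ∀ x ∈ M, ∀ v : Fin n → ℝ,
      v ∈ Submodule.span ℝ (Set.range fun i => Z i x) ↔
        ∀ i, ∑ j, pd (fun y => Ψ y i) j x * v j = 0)
    (x₀ : Fin n → ℝ) (hx₀ : x₀ ∈ M) :
    ∃ Y : Fin r → (Fin n → ℝ) → Fin n → ℝ,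
      -- `Y` is a basis of `𝒢` (an invertible constant-coefficient recombination of `Z`)
      (∃ A : Fin r → Fin r → ℝ, IsUnit (Matrix.det (Matrix.of A)) ∧
        ∀ j, ∀ x, Y j x = ∑ i, A i j • Z i x) ∧
      ∃ U : Set (Fin n → ℝ), IsOpen U ∧ x₀ ∈ U ∧ U ⊆ M ∧
      ∃ (Mt : Set (Fin n → ℝ)) (Φ Φinv : (Fin n → ℝ) → Fin n → ℝ),
        IsOpen Mt ∧ Φ '' U = Mt ∧
        ContDiffOn ℝ (⊤ : ℕ∞) Φ U ∧ ContDiffOn ℝ (⊤ : ℕ∞) Φinv Mt ∧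
        (∀ x ∈ U, Φinv (Φ x) = x) ∧ (∀ y ∈ Mt, Φ (Φinv y) = y) ∧
        -- the last `n - r` components of `Φ` coincide with `Ψ`
        (∀ x ∈ U, ∀ i : Fin p, Φ x ⟨r + (i : ℕ), by omega⟩ = Ψ x i) ∧
        -- the push-forwards `Φ_*(Y_j) = (∇Φ · Y_j) ∘ Φ⁻¹` are in canonical form on `Mt`
        IsCanonicalForm hrn
          (fun j y i => ∑ k, pd (fun z => Φ z i) k (Φinv y) * Y j (Φinv y) k) Mt := by
  have hZd : ∀ x ∈ M, ∀ i, DifferentiableAt ℝ (Z i) x := fun x hx i =>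
    ((hZsmooth i).differentiableOn (by simp)).differentiableAt (hMopen.mem_nhds hx)
  have hΨd : ∀ x ∈ M, DifferentiableAt ℝ Ψ x := fun x hx =>
    (hΨsmooth.differentiableOn (by simp)).differentiableAt (hMopen.mem_nhds hx)
  obtain ⟨b, hb, hbr⟩ := exists_triangular_basis_of_solvableConsts hsolv
  let ev : (Fin n → ℝ) → (Fin r → ℝ) →ₗ[ℝ] (Fin n → ℝ) := fun x =>
    Fintype.linearCombination ℝ fun a => Z a x
  have hev : ∀ x u, ev x u = ∑ a, u a • Z a x := fun x u =>
    Fintype.linearCombination_apply ℝ _ u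
  let Y : Fin r → (Fin n → ℝ) → Fin n → ℝ := fun j x => ∑ a, b j a • Z a x
  have hYev : ∀ x j, Y j x = ev x (b j) := fun x j => (hev x (b j)).symm
  have hY : ∀ j, ContDiffOn ℝ (⊤ : ℕ∞) (Y j) M := fun j =>
    ContDiffOn.sum fun a _ => (hZsmooth a).const_smul (b j a)
  have hYli : ∀ x ∈ M, LinearIndependent ℝ fun j => Y j x := by
    intro x hx
    simp only [hYev]
    exact hb.map' (ev x) (LinearMap.ker_eq_bot.2
      (linearIndependent_iff_injective_fintypeLinearCombination.1 (hZindep x hx)))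
  have hbtop : Submodule.span ℝ (Set.range b) = ⊤ :=
    hb.span_eq_top_of_card_eq_finrank' (by simp)
  have hYspan : ∀ x, Submodule.span ℝ (Set.range fun j => Y j x) =
      Submodule.span ℝ (Set.range fun i => Z i x) := by
    intro x
    have h : (Set.range fun j => Y j x) = ev x '' Set.range b := by
      rw [← Set.range_comp]
      exact congrArg Set.range (funext fun j => hYev x j)
    rw [h, Submodule.span_image, hbtop, Submodule.map_top, Fintype.range_linearCombination]
  have hYbr : ∀ x ∈ M, ∀ m i j, i ≤ m → j ≤ m →
      fderiv ℝ (Y j) x (Y i x) - fderiv ℝ (Y i) x (Y j x) ∈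
        Submodule.span ℝ ((fun l => Y l x) '' {l | l < m}) := by
    intro x hx m i j hi hj
    rw [fderiv_linearCombination_bracket (hZd x hx)
      (fun i j => (vfBracket_eq (hZd x hx i) (hZd x hx j)).symm.trans (hZbr i j x hx)), ← hev]
    simp only [hYev]
    rw [← Function.comp_def, Set.image_comp, Submodule.span_image]
    exact Submodule.mem_map_of_mem (hbr m i j hi hj)
  have hΨker : ∀ x ∈ M, ∀ v, fderiv ℝ Ψ x v = 0 ↔
      v ∈ Submodule.span ℝ (Set.range fun j => Y j x) := by
    intro x hx v
    rw [hYspan, hker x hx, funext_iff]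
    simp only [sum_pd_mul, fderiv_coord (hΨd x hx), Pi.zero_apply]
  obtain ⟨U, hU, hxU, hUM, φ, hφ, hφY⟩ := exists_triangular_functions hMopen hx₀ hY hYli hYbr
    hΨsmooth (by simp only [Module.finrank_fin_fun]; omega) hΨker
  let Φ : (Fin n → ℝ) → Fin n → ℝ := fun x i =>
    if h : (i : ℕ) < r then φ ⟨i, h⟩ x else Ψ x ⟨i - r, by omega⟩
  have hΦφ : ∀ j : Fin r, (fun x => Φ x (Fin.castLE hrn j)) = φ j := fun j => by
    funext x; simp [Φ]
  have hΦΨ : ∀ i : Fin p, (fun x => Φ x ⟨r + (i : ℕ), by omega⟩) = fun x => Ψ x i := fun i => by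
    funext x; simp [Φ]
  have hΦ : ContDiffOn ℝ (⊤ : ℕ∞) Φ U := by
    refine contDiffOn_pi.2 fun i => ?_
    by_cases h : (i : ℕ) < r
    · simpa [Φ, h] using hφ ⟨i, h⟩
    · simpa [Φ, h] using contDiffOn_pi.1 (hΨsmooth.mono hUM) ⟨i - r, by omega⟩
  have hΦd : ∀ x ∈ U, DifferentiableAt ℝ Φ x := fun x hx =>
    (hΦ.differentiableOn (by simp)).differentiableAt (hU.mem_nhds hx)
  obtain ⟨e, hxe, heU, heΦ, he⟩ := exists_openPartialHomeomorph_of_injective_fderiv rfl hU hxU hΦ (by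
    intro v hv
    have hv' : ∀ i, fderiv ℝ (fun x => Φ x i) x₀ v = 0 := fun i => by
      rw [fderiv_coord (hΦd x₀ hxU), hv, Pi.zero_apply]
    have h1 : fderiv ℝ Ψ x₀ v = 0 := funext fun i => by
      rw [← fderiv_coord (hΨd x₀ hx₀), ← hΦΨ]; exact hv' _
    have h2 := mem_span_of_triangular (k := 0)
      (lam := fun i => (fderiv ℝ (φ i) x₀ : (Fin n → ℝ) →ₗ[ℝ] ℝ))
      (fun i _ => (hφY x₀ hxU i).1) (fun i _ => (hφY x₀ hxU i).2) ((hΨker x₀ hx₀ v).1 h1)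
      (fun i _ => by rw [← hΦφ]; exact hv' _)
    simpa using h2)
  refine ⟨Y, ⟨fun i j => b j i, ?_, fun j x => rfl⟩, e.source, e.open_source, hxe, heU.trans hUM,
    e.target, e, e.symm, e.open_target, e.image_source_eq_target, heΦ ▸ hΦ.mono heU, he,
    fun x hx => e.left_inv hx, fun y hy => e.right_inv hy, fun x _ i => ?_, ?_⟩
  · rw [← Matrix.isUnit_iff_isUnit_det, ← Matrix.linearIndependent_cols_iff_isUnit]
    exact hb
  · rw [heΦ]; exact congrFun (hΦΨ i) x
  · simp only [sum_pd_mul, heΦ]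
    have hsU : ∀ y ∈ e.target, e.symm y ∈ U := fun y hy => heU (e.map_target hy)
    refine ⟨r, fun t => t, fun _ _ h => h, rfl, rfl, fun y hy j i hi => ?_,
      fun y hy t i j h1 h2 h3 h4 => ?_, fun y hy t t' htt' i j h1 h2 h3 h4 => ?_⟩
    · have hΦi : (fun z => Φ z i) = fun z => Ψ z ⟨i - r, by omega⟩ :=
        funext fun z => by simp [Φ, hi.not_gt]
      have hy' := hUM (hsU y hy)
      beta_reduce
      rw [hΦi, fderiv_coord (hΨd _ hy'),
        (hΨker _ hy' _).2 (Submodule.subset_span ⟨j, rfl⟩), Pi.zero_apply]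
    · simp only [Fin.val_castSucc, Fin.val_succ] at h1 h2 h3 h4
      obtain rfl : i = j := Fin.ext (by omega)
      beta_reduce
      rw [hΦφ, if_pos rfl]
      exact (hφY _ (hsU y hy) i).1
    · simp only [Fin.val_castSucc, Fin.val_succ] at h1 h2 h3 h4
      beta_reduce
      rw [hΦφ]
      refine (hφY _ (hsU y hy) i).2 j (Fin.lt_def.2 ?_)
      have := Fin.lt_def.1 htt'
      omega
end
end

section
/- Let (μ,σ) be a smooth SDE on an open set M ⊆ ℝ^n, let V = (Y,C,τ) be an infinitesimal symmetry of (μ,σ), and let T = (Φ,B,η) be a stochastic transformation from M to M'. Then T_*(V) is an infinitesimal symmetry of the transformed SDE E_T(μ,σ). -/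
noncomputable section

open scoped BigOperators

/-- Drift `μ' = ((1/η)·L(Φ)) ∘ Φ⁻¹` of the transformed SDE `E_T(μ,σ)`. -/
def transMu {d m : ℕ} (μ : (Fin d → ℝ) → Fin d → ℝ)
    (σ : (Fin d → ℝ) → Fin d → Fin m → ℝ)
    (Φ Φinv : (Fin d → ℝ) → Fin d → ℝ) (η : (Fin d → ℝ) → ℝ) :
    (Fin d → ℝ) → Fin d → ℝ :=
  fun y i => (1 / η (Φinv y)) * gen μ σ (fun z => Φ z i) (Φinv y)

/-- Diffusion `σ' = ((1/√η)·∇Φ·σ·Bᵀ) ∘ Φ⁻¹` of the transformed SDE `E_T(μ,σ)`. -/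
def transSigma {d m : ℕ} (σ : (Fin d → ℝ) → Fin d → Fin m → ℝ)
    (Φ Φinv : (Fin d → ℝ) → Fin d → ℝ)
    (B : (Fin d → ℝ) → Fin m → Fin m → ℝ) (η : (Fin d → ℝ) → ℝ) :
    (Fin d → ℝ) → Fin d → Fin m → ℝ :=
  fun y i a => (1 / Real.sqrt (η (Φinv y))) *
    ∑ j, ∑ b, pd (fun z => Φ z i) j (Φinv y) * σ (Φinv y) j b * B (Φinv y) a b

/-- Push-forward `(∇Φ·Y) ∘ Φ⁻¹` of a vector field. -/
def pushVF {d : ℕ} (Φ Φinv : (Fin d → ℝ) → Fin d → ℝ)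
    (Y : (Fin d → ℝ) → Fin d → ℝ) : (Fin d → ℝ) → Fin d → ℝ :=
  fun y i => ∑ j, pd (fun z => Φ z i) j (Φinv y) * Y (Φinv y) j

/-- The component `(B·C·B⁻¹ + Y(B)·B⁻¹) ∘ Φ⁻¹` of the push-forward `T_*(V)`. -/
def pushC {d m : ℕ} (Φinv : (Fin d → ℝ) → Fin d → ℝ)
    (B : (Fin d → ℝ) → Fin m → Fin m → ℝ)
    (Y : (Fin d → ℝ) → Fin d → ℝ)
    (C : (Fin d → ℝ) → Fin m → Fin m → ℝ) :
    (Fin d → ℝ) → Fin m → Fin m → ℝ :=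
  fun y a b =>
    ((Matrix.of (B (Φinv y)) * Matrix.of (C (Φinv y)) * (Matrix.of (B (Φinv y)))⁻¹
      + Matrix.of (fun a' b' => vfApp Y (fun z => B z a' b') (Φinv y))
        * (Matrix.of (B (Φinv y)))⁻¹ : Matrix (Fin m) (Fin m) ℝ)) a b

/-- The component `(τ + Y(η)·η⁻¹) ∘ Φ⁻¹` of the push-forward `T_*(V)`. -/
def pushTau {d : ℕ} (Φinv : (Fin d → ℝ) → Fin d → ℝ)
    (Y : (Fin d → ℝ) → Fin d → ℝ) (η : (Fin d → ℝ) → ℝ)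
    (τ : (Fin d → ℝ) → ℝ) : (Fin d → ℝ) → ℝ :=
  fun y => τ (Φinv y) + vfApp Y η (Φinv y) / η (Φinv y)

section Calculus

variable {E F G : Type*} [NormedAddCommGroup E] [NormedSpace ℝ E] [NormedAddCommGroup F]
  [NormedSpace ℝ F] [NormedAddCommGroup G] [NormedSpace ℝ G]

open scoped ContDiff

/-- The derivative of a smooth map is smooth. -/
theorem ContDiffAt.fderiv_infty {f : E → F} {x : E} (hf : ContDiffAt ℝ ∞ f x) :
    ContDiffAt ℝ ∞ (fderiv ℝ f) x :=
  hf.fderiv_right (by norm_num)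

theorem ContDiffAt.differentiableAt_infty {f : E → F} {x : E} (hf : ContDiffAt ℝ ∞ f x) :
    DifferentiableAt ℝ f x :=
  hf.differentiableAt (by norm_num)

theorem ContDiffAt.sndFDeriv_comm {f : E → F} {x : E} (hf : ContDiffAt ℝ ∞ f x) (v w : E) :
    fderiv ℝ (fderiv ℝ f) x v w = fderiv ℝ (fderiv ℝ f) x w v :=
  ((hf.of_le (m := 2) (by norm_cast)).isSymmSndFDerivAt
    (by simp [minSmoothness_of_isRCLikeNormedField])).eq v w

/-- Leibniz rule for a differentiable family of linear maps applied to a moving vector. -/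
theorem fderiv_clm_apply_apply {c : E → F →L[ℝ] G} {k : E → F} {x : E}
    (hc : DifferentiableAt ℝ c x) (hk : DifferentiableAt ℝ k x) (v : E) :
    fderiv ℝ (fun z => c z (k z)) x v = fderiv ℝ c x v (k x) + c x (fderiv ℝ k x v) := by
  rw [fderiv_clm_apply hc hk]
  simp [add_comm]

theorem fderiv_clm_apply_const {c : E → F →L[ℝ] G} {x : E}
    (hc : DifferentiableAt ℝ c x) (v : E) (w : F) :
    fderiv ℝ (fun z => c z w) x v = fderiv ℝ c x v w := by
  rw [fderiv_clm_apply_apply hc (differentiableAt_const w)]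
  simp

/-- The second derivative of a composition. -/
theorem sndFDeriv_comp {h : F → G} {φ : E → F} {x : E}
    (hh : ContDiffAt ℝ ∞ h (φ x)) (hφ : ContDiffAt ℝ ∞ φ x) (v w : E) :
    fderiv ℝ (fderiv ℝ (fun z => h (φ z))) x v w =
      fderiv ℝ (fderiv ℝ h) (φ x) (fderiv ℝ φ x v) (fderiv ℝ φ x w)
        + fderiv ℝ h (φ x) (fderiv ℝ (fderiv ℝ φ) x v w) := by
  have hcomp : ContDiffAt ℝ ∞ (fun z => h (φ z)) x := hh.comp x hφ
  have hev : (fun z => fderiv ℝ (fun z => h (φ z)) z w)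
      =ᶠ[nhds x] fun z => fderiv ℝ h (φ z) (fderiv ℝ φ z w) := by
    have h1 := (hφ.of_le (m := 1) (by norm_cast)).eventually (by norm_num)
    have h2 := hφ.continuousAt.eventually
      ((hh.of_le (m := 1) (by norm_cast)).eventually (by norm_num))
    filter_upwards [h1, h2] with z hz1 hz2
    have := fderiv_comp z (hz2.differentiableAt (by norm_num)) (hz1.differentiableAt (by norm_num))
    rw [show (fun z => h (φ z)) = h ∘ φ from rfl, this]
    rfl
  rw [← fderiv_clm_apply_const hcomp.fderiv_infty.differentiableAt_infty, hev.fderiv_eq]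
  have hd : DifferentiableAt ℝ (fun z => fderiv ℝ h (φ z)) x :=
    hh.fderiv_infty.differentiableAt_infty.comp x hφ.differentiableAt_infty
  have hφ' := hφ.fderiv_infty.differentiableAt_infty
  rw [fderiv_clm_apply_apply hd (hφ'.clm_apply (differentiableAt_const w)),
    fderiv_clm_apply_const hφ']
  congr 2
  have := fderiv_comp x hh.fderiv_infty.differentiableAt_infty hφ.differentiableAt_infty
  rw [show (fun z => fderiv ℝ h (φ z)) = fderiv ℝ h ∘ φ from rfl, this]
  rfl

/-- The second derivative of the derivative of `f` along a vector field `Y`. -/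
theorem sndFDeriv_fderiv_apply {f : E → F} {Y : E → E} {x : E}
    (hf : ContDiffAt ℝ ∞ f x) (hY : ContDiffAt ℝ ∞ Y x) (v w : E) :
    fderiv ℝ (fderiv ℝ (fun z => fderiv ℝ f z (Y z))) x v w =
      fderiv ℝ (fderiv ℝ (fderiv ℝ f)) x v w (Y x)
        + fderiv ℝ (fderiv ℝ f) x w (fderiv ℝ Y x v)
        + fderiv ℝ (fderiv ℝ f) x v (fderiv ℝ Y x w)
        + fderiv ℝ f x (fderiv ℝ (fderiv ℝ Y) x v w) := by
  have hf1 := hf.fderiv_infty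
  have hf2 := hf1.fderiv_infty.differentiableAt_infty
  have hg : ContDiffAt ℝ ∞ (fun z => fderiv ℝ f z (Y z)) x := hf1.clm_apply hY
  have hev : (fun z => fderiv ℝ (fun z => fderiv ℝ f z (Y z)) z w)
      =ᶠ[nhds x] fun z => fderiv ℝ (fderiv ℝ f) z w (Y z) + fderiv ℝ f z (fderiv ℝ Y z w) := by
    have h1 := (hf1.of_le (m := 1) (by norm_cast)).eventually (by norm_num)
    have h2 := (hY.of_le (m := 1) (by norm_cast)).eventually (by norm_num)
    filter_upwards [h1, h2] with z hz1 hz2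
    exact fderiv_clm_apply_apply (hz1.differentiableAt (by norm_num))
      (hz2.differentiableAt (by norm_num)) w
  have hw : DifferentiableAt ℝ (fun z => fderiv ℝ (fderiv ℝ f) z w) x :=
    hf2.clm_apply (differentiableAt_const w)
  have hY1 := hY.fderiv_infty.differentiableAt_infty
  have hYw : DifferentiableAt ℝ (fun z => fderiv ℝ Y z w) x :=
    hY1.clm_apply (differentiableAt_const w)
  have hY0 := hY.differentiableAt_infty
  have hf1' := hf1.differentiableAt_infty
  rw [← fderiv_clm_apply_const hg.fderiv_infty.differentiableAt_infty, hev.fderiv_eq,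
    fderiv_fun_add (hw.clm_apply hY0) (hf1'.clm_apply hYw), _root_.add_apply,
    fderiv_clm_apply_apply hw hY0, fderiv_clm_apply_apply hf1' hYw,
    fderiv_clm_apply_const hf2, fderiv_clm_apply_const hY1]
  abel

/-- The third derivative of a smooth map is invariant under rotation of its arguments. -/
theorem trdFDeriv_rotate {f : E → F} {x : E} (hf : ContDiffAt ℝ ∞ f x) (u v w : E) :
    fderiv ℝ (fderiv ℝ (fderiv ℝ f)) x u v w = fderiv ℝ (fderiv ℝ (fderiv ℝ f)) x v w u := by
  have h2 := hf.fderiv_infty.fderiv_infty.differentiableAt_infty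
  rw [hf.fderiv_infty.sndFDeriv_comm]
  have key : ∀ a b, fderiv ℝ (fun z => fderiv ℝ (fderiv ℝ f) z a b) x v
      = fderiv ℝ (fderiv ℝ (fderiv ℝ f)) x v a b := fun a b => by
    rw [fderiv_clm_apply_const (h2.clm_apply (differentiableAt_const a)),
      fderiv_clm_apply_const h2]
  rw [← key, ← key]
  congr 1
  apply Filter.EventuallyEq.fderiv_eq
  filter_upwards [(hf.of_le (m := 2) (by norm_cast)).eventually (by norm_num)] with z hz
  exact (hz.isSymmSndFDerivAt (by simp [minSmoothness_of_isRCLikeNormedField])).eq u w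

/-- The second-order operator `½ ∑ D²f(s, s) + Df(v)`, without coordinates. -/
def diffusionOp {ι : Type*} [Fintype ι] (v : E → E) (s : ι → E → E) (f : E → ℝ) (x : E) : ℝ :=
  (1/2) * ∑ a, fderiv ℝ (fderiv ℝ f) x (s a x) (s a x) + fderiv ℝ f x (v x)

variable {ι : Type*} [Fintype ι]

theorem ContDiffAt.diffusionOp {v : E → E} {s : ι → E → E} {f : E → ℝ} {x : E}
    (hf : ContDiffAt ℝ ∞ f x) (hv : ContDiffAt ℝ ∞ v x) (hs : ∀ a, ContDiffAt ℝ ∞ (s a) x) :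
    ContDiffAt ℝ ∞ (diffusionOp v s f) x := by
  refine ContDiffAt.add (contDiffAt_const.mul (ContDiffAt.sum fun a _ => ?_))
    (hf.fderiv_infty.clm_apply hv)
  exact (hf.fderiv_infty.fderiv_infty.clm_apply (hs a)).clm_apply (hs a)

/-- A symmetry `Y` of a diffusion operator satisfies `[Y, L] = -τ L`. -/
theorem fderiv_diffusionOp_sub_eq {v : E → E} {s : ι → E → E} {f : E → ℝ} {Y : E → E} {x : E}
    {C : ι → ι → ℝ} {t : ℝ}
    (hf : ContDiffAt ℝ ∞ f x) (hv : ContDiffAt ℝ ∞ v x) (hs : ∀ a, ContDiffAt ℝ ∞ (s a) x)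
    (hY : ContDiffAt ℝ ∞ Y x) (hC : ∀ a b, C a b = -C b a)
    (hσ : ∀ a, fderiv ℝ (s a) x (Y x) - fderiv ℝ Y x (s a x)
      = (-(1/2) * t) • s a x - ∑ b, C b a • s b x)
    (hμ : fderiv ℝ v x (Y x) - ((1/2 : ℝ) • ∑ a, fderiv ℝ (fderiv ℝ Y) x (s a x) (s a x)
      + fderiv ℝ Y x (v x)) = (-t) • v x) :
    fderiv ℝ (diffusionOp v s f) x (Y x) - diffusionOp v s (fun z => fderiv ℝ f z (Y z)) x
      = -t * diffusionOp v s f x := by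
  have hf1 := hf.fderiv_infty
  have hf2 := hf1.fderiv_infty
  have hds : ∀ a, DifferentiableAt ℝ (s a) x := fun a => (hs a).differentiableAt_infty
  have hdf2 := hf2.differentiableAt_infty
  have hda : ∀ a, DifferentiableAt ℝ (fun z => fderiv ℝ (fderiv ℝ f) z (s a z)) x :=
    fun a => hdf2.clm_apply (hds a)
  have hdaa : ∀ a, DifferentiableAt ℝ (fun z => fderiv ℝ (fderiv ℝ f) z (s a z) (s a z)) x :=
    fun a => (hda a).clm_apply (hds a)
  have hdv := hv.differentiableAt_infty
  have hdf1 := hf1.differentiableAt_infty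
  set D1 := fderiv ℝ f x with hD1
  set D2 := fderiv ℝ (fderiv ℝ f) x with hD2
  have e1 : fderiv ℝ (diffusionOp v s f) x (Y x)
      = (1/2) * ∑ a, (fderiv ℝ (fderiv ℝ (fderiv ℝ f)) x (s a x) (s a x) (Y x)
          + 2 * D2 (fderiv ℝ (s a) x (Y x)) (s a x))
        + (D2 (Y x) (v x) + D1 (fderiv ℝ v x (Y x))) := by
    unfold diffusionOp
    rw [fderiv_fun_add ((DifferentiableAt.fun_sum fun a _ => hdaa a).const_mul _)
        (hdf1.clm_apply hdv), _root_.add_apply, fderiv_clm_apply_apply hdf1 hdv,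
      fderiv_const_mul (DifferentiableAt.fun_sum fun a _ => hdaa a),
      fderiv_fun_sum fun a _ => hdaa a]
    simp only [_root_.smul_apply, _root_.sum_apply, smul_eq_mul]
    congr 2
    refine Finset.sum_congr rfl fun a _ => ?_
    rw [fderiv_clm_apply_apply (hda a) (hds a), fderiv_clm_apply_apply hdf2 (hds a),
      _root_.add_apply, trdFDeriv_rotate hf, ← hD2,
      hf.sndFDeriv_comm (s a x) (fderiv ℝ (s a) x (Y x))]
    ring
  have e2 : diffusionOp v s (fun z => fderiv ℝ f z (Y z)) x
      = (1/2) * ∑ a, (fderiv ℝ (fderiv ℝ (fderiv ℝ f)) x (s a x) (s a x) (Y x)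
          + 2 * D2 (fderiv ℝ Y x (s a x)) (s a x) + D1 (fderiv ℝ (fderiv ℝ Y) x (s a x) (s a x)))
        + (D2 (Y x) (v x) + D1 (fderiv ℝ Y x (v x))) := by
    unfold diffusionOp
    rw [fderiv_clm_apply_apply hdf1 hY.differentiableAt_infty, ← hD2, hf.sndFDeriv_comm (v x)]
    congr 2
    refine Finset.sum_congr rfl fun a _ => ?_
    rw [sndFDeriv_fderiv_apply hf hY, ← hD2, hf.sndFDeriv_comm (s a x) (fderiv ℝ Y x (s a x))]
    ring
  have hσ' : ∑ a, D2 (fderiv ℝ (s a) x (Y x)) (s a x) - ∑ a, D2 (fderiv ℝ Y x (s a x)) (s a x)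
      = -(1/2) * t * ∑ a, D2 (s a x) (s a x) - ∑ a, ∑ b, C b a * D2 (s b x) (s a x) := by
    rw [← Finset.sum_sub_distrib, Finset.mul_sum, ← Finset.sum_sub_distrib]
    refine Finset.sum_congr rfl fun a _ => ?_
    rw [← _root_.sub_apply, ← map_sub, hσ]
    simp
  have hanti : ∑ a, ∑ b, C b a * D2 (s b x) (s a x) = 0 := by
    have : ∑ a, ∑ b, C b a * D2 (s b x) (s a x) = -∑ a, ∑ b, C b a * D2 (s b x) (s a x) := by
      conv_lhs => rw [Finset.sum_comm]
      rw [← Finset.sum_neg_distrib]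
      refine Finset.sum_congr rfl fun a _ => ?_
      rw [← Finset.sum_neg_distrib]
      refine Finset.sum_congr rfl fun b _ => ?_
      rw [hC a b, hf.sndFDeriv_comm (s a x)]
      ring
    linarith
  have hμ' := congrArg D1 hμ
  simp only [map_sub, map_add, map_smul, map_sum, smul_eq_mul] at hμ'
  rw [e1, e2]
  simp only [diffusionOp, Finset.sum_add_distrib, ← Finset.mul_sum, ← hD1, ← hD2]
  rw [hanti] at hσ'
  linear_combination hσ' + hμ'

/-- How a diffusion operator changes under a map `φ`, a rotation `B` of the noise and a rescaling
`r ^ 2` of time. -/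
theorem diffusionOp_comp {v : E → E} {s : ι → E → E} {v' : F → F} {s' : ι → F → F}
    {φ : E → F} {h : F → ℝ} {x : E} {B : ι → ι → ℝ} {r : ℝ} [DecidableEq ι]
    (hh : ContDiffAt ℝ ∞ h (φ x)) (hφ : ContDiffAt ℝ ∞ φ x)
    (hB : ∀ b c, ∑ a, B a b * B a c = if b = c then (1 : ℝ) else 0)
    (hs : ∀ a, s' a (φ x) = r • ∑ b, B a b • fderiv ℝ φ x (s b x))
    (hv : v' (φ x) = (r ^ 2) • ((1/2 : ℝ) • ∑ a, fderiv ℝ (fderiv ℝ φ) x (s a x) (s a x)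
      + fderiv ℝ φ x (v x))) :
    diffusionOp v' s' h (φ x) = r ^ 2 * diffusionOp v s (fun z => h (φ z)) x := by
  have hrot : ∑ a, fderiv ℝ (fderiv ℝ h) (φ x) (s' a (φ x)) (s' a (φ x))
      = r ^ 2 * ∑ b, fderiv ℝ (fderiv ℝ h) (φ x) (fderiv ℝ φ x (s b x)) (fderiv ℝ φ x (s b x)) := by
    simp only [hs, map_smul, map_sum, _root_.smul_apply, _root_.sum_apply, smul_eq_mul,
      Finset.mul_sum]
    rw [Finset.sum_comm]
    refine Finset.sum_congr rfl fun b _ => ?_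
    rw [Finset.sum_comm]
    rw [Finset.sum_eq_single b]
    · have := hB b b
      simp only [if_true] at this
      set d := fderiv ℝ (fderiv ℝ h) (φ x) (fderiv ℝ φ x (s b x)) (fderiv ℝ φ x (s b x))
      calc _ = r ^ 2 * d * ∑ a, B a b * B a b := by
            rw [Finset.mul_sum]
            exact Finset.sum_congr rfl fun a _ => by ring
        _ = _ := by rw [this, mul_one]
    · intro c _ hc
      have := hB b c
      rw [if_neg (Ne.symm hc)] at this
      set d := fderiv ℝ (fderiv ℝ h) (φ x) (fderiv ℝ φ x (s c x)) (fderiv ℝ φ x (s b x))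
      calc _ = r ^ 2 * d * ∑ a, B a b * B a c := by
            rw [Finset.mul_sum]
            exact Finset.sum_congr rfl fun a _ => by ring
        _ = _ := by rw [this, mul_zero]
    · simp
  unfold diffusionOp
  rw [hrot, hv]
  have hφs : ∀ a, fderiv ℝ (fderiv ℝ (fun z => h (φ z))) x (s a x) (s a x) = _ :=
    fun a => sndFDeriv_comp hh hφ _ _
  have hφ1 : fderiv ℝ (fun z => h (φ z)) x (v x) = fderiv ℝ h (φ x) (fderiv ℝ φ x (v x)) := by
    rw [show (fun z => h (φ z)) = h ∘ φ from rfl,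
      fderiv_comp x hh.differentiableAt_infty hφ.differentiableAt_infty]
    rfl
  simp only [hφs, hφ1, Finset.sum_add_distrib, map_smul, map_add, map_sum, smul_eq_mul]
  ring

/-- The differential of `f` intertwines the Lie bracket of `Y` and `k`. -/
theorem fderiv_fderiv_apply_sub {f : E → ℝ} {Y k : E → E} {x : E}
    (hf : ContDiffAt ℝ ∞ f x) (hY : DifferentiableAt ℝ Y x) (hk : DifferentiableAt ℝ k x) :
    fderiv ℝ (fun z => fderiv ℝ f z (k z)) x (Y x) - fderiv ℝ (fun z => fderiv ℝ f z (Y z)) x (k x)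
      = fderiv ℝ f x (fderiv ℝ k x (Y x) - fderiv ℝ Y x (k x)) := by
  have hf1 := hf.fderiv_infty.differentiableAt_infty
  rw [fderiv_clm_apply_apply hf1 hk, fderiv_clm_apply_apply hf1 hY,
    hf.sndFDeriv_comm (Y x) (k x), map_sub]
  ring

/-- The bracket of `Y` with a combination `r ∑ Bᵦ sᵦ` of vector fields. -/
theorem bracket_smul_sum {Y : E → E} {s : ι → E → E} {r : E → ℝ} {B : ι → E → ℝ} {x : E}
    (hr : DifferentiableAt ℝ r x) (hB : ∀ b, DifferentiableAt ℝ (B b) x)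
    (hs : ∀ b, DifferentiableAt ℝ (s b) x) (w : E) :
    fderiv ℝ (fun z => r z • ∑ b, B b z • s b z) x w - fderiv ℝ Y x (r x • ∑ b, B b x • s b x)
      = fderiv ℝ r x w • ∑ b, B b x • s b x + r x • ∑ b, fderiv ℝ (B b) x w • s b x
        + r x • ∑ b, B b x • (fderiv ℝ (s b) x w - fderiv ℝ Y x (s b x)) := by
  have h1 : ∀ b, DifferentiableAt ℝ (fun z => B b z • s b z) x := fun b => (hB b).fun_smul (hs b)
  rw [fderiv_fun_smul hr (DifferentiableAt.fun_sum fun b _ => h1 b),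
    fderiv_fun_sum fun b _ => h1 b]
  have h2 : ∀ b, fderiv ℝ (fun z => B b z • s b z) x = _ := fun b => fderiv_fun_smul (hB b) (hs b)
  simp only [h2, _root_.add_apply, _root_.smul_apply, _root_.sum_apply,
    ContinuousLinearMap.smulRight_apply, map_smul, map_sum, smul_sub, Finset.sum_add_distrib,
    Finset.sum_sub_distrib, smul_add]
  abel

theorem fderiv_apply_coord {κ : Type*} {g : E → κ → ℝ} {x : E} (hg : DifferentiableAt ℝ g x) (i : κ) (w : E) :
    fderiv ℝ (fun z => g z i) x w = fderiv ℝ g x w i := by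
  rw [((hasFDerivAt_pi'.1 hg.hasFDerivAt) i).fderiv]
  rfl

theorem sndFDeriv_apply_coord {κ : Type*} [Fintype κ] {g : E → κ → ℝ} {x : E}
    (hg : ContDiffAt ℝ ∞ g x) (i : κ) (v w : E) :
    fderiv ℝ (fderiv ℝ (fun z => g z i)) x v w = fderiv ℝ (fderiv ℝ g) x v w i := by
  have hgi : ContDiffAt ℝ ∞ (fun z => g z i) x := contDiffAt_pi.1 hg i
  have hg1 := hg.fderiv_infty.differentiableAt_infty
  rw [← fderiv_clm_apply_const hgi.fderiv_infty.differentiableAt_infty,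
    ← fderiv_clm_apply_const hg1,
    ← fderiv_apply_coord (hg1.clm_apply (differentiableAt_const w))]
  congr 1
  apply Filter.EventuallyEq.fderiv_eq
  filter_upwards [(hg.of_le (m := 1) (by norm_cast)).eventually (by norm_num)] with z hz
  exact fderiv_apply_coord (hz.differentiableAt (by norm_num)) i w

end Calculus

section Coordinates

open scoped ContDiff

variable {d m : ℕ}

theorem sum_mul_apply_single (L : (Fin d → ℝ) →L[ℝ] ℝ) (v : Fin d → ℝ) :
    ∑ k, v k * L (Pi.single k 1) = L v := by
  conv_rhs => rw [← Finset.univ_sum_single v]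
  rw [map_sum]
  refine Finset.sum_congr rfl fun k _ => ?_
  rw [← smul_eq_mul, ← map_smul, ← Pi.single_smul, smul_eq_mul, mul_one]

theorem vfApp_eq_fderiv (Y : (Fin d → ℝ) → Fin d → ℝ) (f : (Fin d → ℝ) → ℝ) (x : Fin d → ℝ) :
    vfApp Y f x = fderiv ℝ f x (Y x) :=
  sum_mul_apply_single _ _

theorem mixBracket_eq_fderiv (H : (Fin d → ℝ) → Fin d → ℝ)
    (K : (Fin d → ℝ) → Fin d → Fin m → ℝ) (x : Fin d → ℝ) (i : Fin d) (a : Fin m) :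
    mixBracket H K x i a = fderiv ℝ (fun z => K z i a) x (H x)
      - fderiv ℝ (fun z => H z i) x (fun k => K x k a) := by
  rw [← sum_mul_apply_single, ← sum_mul_apply_single, ← Finset.sum_sub_distrib]
  rfl

theorem gen_eq_diffusionOp (μ : (Fin d → ℝ) → Fin d → ℝ) (σ : (Fin d → ℝ) → Fin d → Fin m → ℝ)
    {f : (Fin d → ℝ) → ℝ} {x : Fin d → ℝ} (hf : ContDiffAt ℝ ∞ f x) :
    gen μ σ f x = diffusionOp μ (fun a z i => σ z i a) f x := by
  unfold gen diffusionOp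
  rw [← sum_mul_apply_single (fderiv ℝ f x)]
  congr 2
  refine Finset.sum_congr rfl fun a _ => ?_
  rw [← sum_mul_apply_single]
  rw [Finset.sum_comm]
  refine Finset.sum_congr rfl fun j _ => ?_
  rw [← fderiv_clm_apply_const hf.fderiv_infty.differentiableAt_infty, ← sum_mul_apply_single,
    Finset.mul_sum]
  refine Finset.sum_congr rfl fun i _ => ?_
  simp only [pd]
  ring

theorem pushVF_eq (Φ Φinv Y : (Fin d → ℝ) → Fin d → ℝ) (y : Fin d → ℝ) (i : Fin d) :
    pushVF Φ Φinv Y y i = fderiv ℝ (fun z => Φ z i) (Φinv y) (Y (Φinv y)) := by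
  rw [← sum_mul_apply_single]
  exact Finset.sum_congr rfl fun j _ => mul_comm _ _

theorem transSigma_eq (σ : (Fin d → ℝ) → Fin d → Fin m → ℝ) (Φ Φinv : (Fin d → ℝ) → Fin d → ℝ)
    (B : (Fin d → ℝ) → Fin m → Fin m → ℝ) (η : (Fin d → ℝ) → ℝ) (y : Fin d → ℝ)
    (i : Fin d) (a : Fin m) :
    transSigma σ Φ Φinv B η y i a = fderiv ℝ (fun z => Φ z i) (Φinv y)
      ((1 / √(η (Φinv y))) • ∑ b, B (Φinv y) a b • fun k => σ (Φinv y) k b) := by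
  simp only [transSigma, map_smul, map_sum, smul_eq_mul]
  rw [Finset.sum_comm]
  congr 1
  refine Finset.sum_congr rfl fun b _ => ?_
  rw [← sum_mul_apply_single, Finset.mul_sum]
  refine Finset.sum_congr rfl fun j _ => ?_
  simp only [pd]
  ring

/-- Entrywise form of `Bᵀ (B C B⁻¹ + D B⁻¹) = C Bᵀ - Dᵀ`, where `D` is tangent at `B` to the
orthogonal group. -/
theorem transpose_mul_gauge {B C D : Matrix (Fin m) (Fin m) ℝ} (hB : B * B.transpose = 1)
    (hD : D * B.transpose + B * D.transpose = 0) :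
    B.transpose * (B * C * B⁻¹ + D * B⁻¹) = C * B.transpose - D.transpose := by
  have hB' : B.transpose * B = 1 := mul_eq_one_comm.1 hB
  rw [Matrix.inv_eq_right_inv hB, eq_neg_of_add_eq_zero_left hD, mul_add, mul_neg,
    ← mul_assoc, ← mul_assoc, ← mul_assoc, hB', one_mul, one_mul, sub_eq_add_neg]

/-- The vector form of the determining equations. -/
theorem IsSymmetry.vector_eqs {M : Set (Fin d → ℝ)} {μ : (Fin d → ℝ) → Fin d → ℝ}
    {σ : (Fin d → ℝ) → Fin d → Fin m → ℝ} {Y : (Fin d → ℝ) → Fin d → ℝ}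
    {C : (Fin d → ℝ) → Fin m → Fin m → ℝ} {τ : (Fin d → ℝ) → ℝ} {x : Fin d → ℝ}
    (h : IsSymmetry M μ σ Y C τ) (hx : x ∈ M) (hμ : DifferentiableAt ℝ μ x)
    (hσ : ∀ a, DifferentiableAt ℝ (fun z i => σ z i a) x) (hY : ContDiffAt ℝ ∞ Y x) :
    (∀ a, fderiv ℝ (fun z i => σ z i a) x (Y x) - fderiv ℝ Y x (fun i => σ x i a)
      = (-(1/2) * τ x) • (fun i => σ x i a) - ∑ b, C x b a • fun i => σ x i b) ∧
    fderiv ℝ μ x (Y x) - ((1/2 : ℝ) • ∑ a, fderiv ℝ (fderiv ℝ Y) x (fun i => σ x i a)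
      (fun i => σ x i a) + fderiv ℝ Y x (μ x)) = (-τ x) • μ x := by
  have hYi : ∀ i, ContDiffAt ℝ ∞ (fun z => Y z i) x := contDiffAt_pi.1 hY
  constructor
  · intro a
    ext i
    have := h.1 x hx i a
    rw [mixBracket_eq_fderiv, fderiv_apply_coord (g := fun z i => σ z i a) (hσ a),
      fderiv_apply_coord hY.differentiableAt_infty] at this
    simp only [Pi.sub_apply, Pi.smul_apply, Finset.sum_apply, smul_eq_mul, this]
    simp only [mul_comm]
  · ext i
    have := h.2 x hx i
    rw [gen_eq_diffusionOp μ σ (hYi i), vfApp_eq_fderiv, fderiv_apply_coord hμ] at this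
    unfold diffusionOp at this
    simp only [sndFDeriv_apply_coord hY, fderiv_apply_coord hY.differentiableAt_infty] at this
    simpa [Finset.sum_apply] using this

theorem fderiv_one_div_sqrt {E : Type*} [NormedAddCommGroup E] [NormedSpace ℝ E] {η : E → ℝ}
    {x : E} (hη : DifferentiableAt ℝ η x) (hpos : 0 < η x) (w : E) :
    fderiv ℝ (fun z => 1 / √(η z)) x w = -(1/2) * (fderiv ℝ η x w / η x) * (1 / √(η x)) := by
  have hs : √(η x) ≠ 0 := (Real.sqrt_pos.2 hpos).ne'
  have h := ((hasDerivAt_inv hs).comp_hasFDerivAt x (hη.hasFDerivAt.sqrt hpos.ne')).fderiv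
  rw [show (fun z => 1 / √(η z)) = (fun t : ℝ => t⁻¹) ∘ fun z => √(η z) from
    funext fun z => one_div _, h]
  have hsq : √(η x) ^ 2 = η x := Real.sq_sqrt hpos.le
  simp only [_root_.smul_apply, smul_eq_mul]
  rw [hsq]
  field_simp

end Coordinates

/-- Theorem 3.5.  If `V = (Y,C,τ)` is an infinitesimal symmetry of the SDE
`(μ,σ)` and `T = (Φ,B,η)` is a stochastic transformation from `M` to `M'`, then `T_*(V)` is an
infinitesimal symmetry of the transformed SDE `E_T(μ,σ)`. -/
theorem pushforward_of_symmetry_is_symmetry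
    {n m : ℕ}
    (M M' : Set (Fin n → ℝ)) (hMopen : IsOpen M) (hM'open : IsOpen M')
    (μ : (Fin n → ℝ) → Fin n → ℝ) (σ : (Fin n → ℝ) → Fin n → Fin m → ℝ)
    (hμsmooth : ContDiffOn ℝ (⊤ : ℕ∞) μ M) (hσsmooth : ContDiffOn ℝ (⊤ : ℕ∞) σ M)
    -- the stochastic transformation `T = (Φ,B,η)` from `M` to `M'`
    (Φ Φinv : (Fin n → ℝ) → Fin n → ℝ)
    (hΦsmooth : ContDiffOn ℝ (⊤ : ℕ∞) Φ M) (hΦinvsmooth : ContDiffOn ℝ (⊤ : ℕ∞) Φinv M')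
    (hΦim : Φ '' M = M')
    (hΦleft : ∀ x ∈ M, Φinv (Φ x) = x) (hΦright : ∀ y ∈ M', Φ (Φinv y) = y)
    (B : (Fin n → ℝ) → Fin m → Fin m → ℝ) (η : (Fin n → ℝ) → ℝ)
    (hBsmooth : ContDiffOn ℝ (⊤ : ℕ∞) B M) (hηsmooth : ContDiffOn ℝ (⊤ : ℕ∞) η M)
    (hBorth : ∀ x ∈ M, ∀ a b, ∑ e, B x a e * B x b e = if a = b then (1:ℝ) else 0)
    (hBdet : ∀ x ∈ M, Matrix.det (Matrix.of (B x)) = 1)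
    (hηpos : ∀ x ∈ M, 0 < η x)
    -- the infinitesimal symmetry `V = (Y,C,τ)` of `(μ,σ)`
    (Y : (Fin n → ℝ) → Fin n → ℝ) (C : (Fin n → ℝ) → Fin m → Fin m → ℝ)
    (τ : (Fin n → ℝ) → ℝ)
    (hYsmooth : ContDiffOn ℝ (⊤ : ℕ∞) Y M) (hCsmooth : ContDiffOn ℝ (⊤ : ℕ∞) C M)
    (hτsmooth : ContDiffOn ℝ (⊤ : ℕ∞) τ M)
    (hCso : ∀ x ∈ M, ∀ a b, C x a b = - C x b a)
    (hsym : IsSymmetry M μ σ Y C τ) :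
    IsSymmetry M' (transMu μ σ Φ Φinv η) (transSigma σ Φ Φinv B η)
      (pushVF Φ Φinv Y) (pushC Φinv B Y C) (pushTau Φinv Y η τ) := by
  have atM : ∀ {W : Type} [NormedAddCommGroup W] [NormedSpace ℝ W] {g : (Fin n → ℝ) → W}
      {x : Fin n → ℝ}, ContDiffOn ℝ (⊤ : ℕ∞) g M → x ∈ M → ContDiffAt ℝ (⊤ : ℕ∞) g x :=
    fun hg hx => hg.contDiffAt (hMopen.mem_nhds hx)
  have hmem : ∀ x ∈ M, Φ x ∈ M' := fun x hx => hΦim ▸ Set.mem_image_of_mem Φ hx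
  have hΦi : ∀ x ∈ M, ∀ i, ContDiffAt ℝ (⊤ : ℕ∞) (fun z => Φ z i) x := fun x hx =>
    contDiffAt_pi.1 (atM hΦsmooth hx)
  have hs : ∀ x ∈ M, ∀ a, ContDiffAt ℝ (⊤ : ℕ∞) (fun z i => σ z i a) x := fun x hx a =>
    contDiffAt_pi.2 fun i => contDiffAt_pi.1 (contDiffAt_pi.1 (atM hσsmooth hx) i) a
  have hBab : ∀ x ∈ M, ∀ a b, ContDiffAt ℝ (⊤ : ℕ∞) (fun z => B z a b) x := fun x hx a =>
    contDiffAt_pi.1 (contDiffAt_pi.1 (atM hBsmooth hx) a)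
  -- functions on `M` transported to `M'` along `Φ`
  have hpush : ∀ g : (Fin n → ℝ) → ℝ, ∀ x ∈ M, ContDiffAt ℝ (⊤ : ℕ∞) g x →
      ContDiffAt ℝ (⊤ : ℕ∞) (fun y => g (Φinv y)) (Φ x) := by
    intro g x hx hg
    refine ContDiffAt.comp (Φ x) (g := g) ?_
      (hΦinvsmooth.contDiffAt (hM'open.mem_nhds (hmem x hx)))
    rwa [hΦleft x hx]
  have hpull : ∀ g : (Fin n → ℝ) → ℝ, ∀ x ∈ M, (fun z => g (Φinv (Φ z))) =ᶠ[nhds x] g := by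
    intro g x hx
    filter_upwards [hMopen.mem_nhds hx] with z hz
    rw [hΦleft z hz]
  have hpushd : ∀ g : (Fin n → ℝ) → ℝ, ∀ x ∈ M, ContDiffAt ℝ (⊤ : ℕ∞) g x → ∀ w,
      fderiv ℝ (fun y => g (Φinv y)) (Φ x) (fderiv ℝ Φ x w) = fderiv ℝ g x w := by
    intro g x hx hg w
    rw [← (hpull g x hx).fderiv_eq,
      show (fun z => g (Φinv (Φ z))) = (fun y => g (Φinv y)) ∘ Φ from rfl,
      fderiv_comp x (hpush g x hx hg).differentiableAt_infty
        (atM hΦsmooth hx).differentiableAt_infty]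
    rfl
  have hpushVF : ∀ x ∈ M, pushVF Φ Φinv Y (Φ x) = fderiv ℝ Φ x (Y x) := by
    intro x hx
    ext i
    rw [pushVF_eq, hΦleft x hx, fderiv_apply_coord (atM hΦsmooth hx).differentiableAt_infty]
  have hYΦ : ∀ x ∈ M, ∀ i,
      ContDiffAt ℝ (⊤ : ℕ∞) (fun z => fderiv ℝ (fun z => Φ z i) z (Y z)) x := fun x hx i =>
    (hΦi x hx i).fderiv_infty.clm_apply (atM hYsmooth hx)
  have hpushVFfun : ∀ i, (fun y => pushVF Φ Φinv Y y i)
      = fun y => (fun z => fderiv ℝ (fun z => Φ z i) z (Y z)) (Φinv y) := fun i =>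
    funext fun y => pushVF_eq Φ Φinv Y y i
  have hsqrt : ∀ x ∈ M, ContDiffAt ℝ (⊤ : ℕ∞) (fun z => 1 / √(η z)) x := fun x hx =>
    contDiffAt_const.div ((atM hηsmooth hx).sqrt (hηpos x hx).ne')
      (Real.sqrt_pos.2 (hηpos x hx)).ne'
  have hk : ∀ x ∈ M, ∀ a, ContDiffAt ℝ (⊤ : ℕ∞)
      (fun z => (1 / √(η z)) • ∑ b, B z a b • fun k => σ z k b) x := fun x hx a =>
    (hsqrt x hx).smul (ContDiffAt.sum fun b _ => (hBab x hx a b).smul (hs x hx b))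
  have hsx : ∀ x ∈ M, ∀ a, (fun i => transSigma σ Φ Φinv B η (Φ x) i a)
      = fderiv ℝ Φ x ((1 / √(η x)) • ∑ b, B x a b • fun k => σ x k b) := by
    intro x hx a
    ext i
    rw [transSigma_eq, hΦleft x hx, fderiv_apply_coord (atM hΦsmooth hx).differentiableAt_infty]
  constructor
  · intro y hy i a
    obtain ⟨x, hx, rfl⟩ : ∃ x ∈ M, Φ x = y := by rwa [← hΦim] at hy
    obtain ⟨hbr, -⟩ := hsym.vector_eqs hx (atM hμsmooth hx).differentiableAt_infty
      (fun a => (hs x hx a).differentiableAt_infty) (atM hYsmooth hx)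
    have hσfun : (fun y => transSigma σ Φ Φinv B η y i a) = fun y => (fun z =>
        fderiv ℝ (fun z => Φ z i) z ((1 / √(η z)) • ∑ b, B z a b • fun k => σ z k b)) (Φinv y) :=
      funext fun y => transSigma_eq σ Φ Φinv B η y i a
    rw [mixBracket_eq_fderiv, hσfun, hpushVF x hx, hsx x hx, hpushVFfun,
      hpushd _ x hx ((hΦi x hx i).fderiv_infty.clm_apply (hk x hx a)),
      hpushd _ x hx (hYΦ x hx i),
      fderiv_fderiv_apply_sub (hΦi x hx i) (atM hYsmooth hx).differentiableAt_infty
        (hk x hx a).differentiableAt_infty,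
      bracket_smul_sum (s := fun b z k => σ z k b) (r := fun z => 1 / √(η z))
        (B := fun b z => B z a b) (hsqrt x hx).differentiableAt_infty
        (fun b => (hBab x hx a b).differentiableAt_infty)
        (fun b => (hs x hx b).differentiableAt_infty),
      fderiv_one_div_sqrt (atM hηsmooth hx).differentiableAt_infty (hηpos x hx)]
    simp only [hbr, transSigma_eq, pushTau, pushC, hΦleft x hx, vfApp_eq_fderiv]
    set D1 := fderiv ℝ (fun z => Φ z i) x
    set S : Fin m → ℝ := fun b => D1 fun k => σ x k b with hS
    set Bm : Matrix (Fin m) (Fin m) ℝ := Matrix.of (B x) with hBm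
    set Cm : Matrix (Fin m) (Fin m) ℝ := Matrix.of (C x) with hCm
    set Dm : Matrix (Fin m) (Fin m) ℝ :=
      Matrix.of (fun a b => fderiv ℝ (fun z => B z a b) x (Y x)) with hDm
    have hBB : Bm * Bm.transpose = 1 := by
      ext a b
      simpa [Matrix.mul_apply, Matrix.one_apply, hBm] using hBorth x hx a b
    have hDB : Dm * Bm.transpose + Bm * Dm.transpose = 0 := by
      ext a b
      have hconst : (fun z => ∑ e, B z a e * B z b e)
          =ᶠ[nhds x] fun _ => if a = b then (1:ℝ) else 0 := by
        filter_upwards [hMopen.mem_nhds hx] with z hz using hBorth z hz a b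
      have hd := fun a b => (hBab x hx a b).differentiableAt_infty
      have h0 := congrArg (fun L : (Fin n → ℝ) →L[ℝ] ℝ => L (Y x)) (hconst.fderiv_eq (𝕜 := ℝ))
      simp only [fderiv_fun_sum fun e (_ : e ∈ Finset.univ) => (hd a e).fun_mul (hd b e),
        fderiv_fun_mul (hd a _) (hd b _), fderiv_const_apply, _root_.sum_apply,
        _root_.add_apply, _root_.smul_apply, _root_.zero_apply, smul_eq_mul] at h0
      simp only [Matrix.add_apply, Matrix.mul_apply, Matrix.transpose_apply, Matrix.zero_apply,
        hBm, hDm, Matrix.of_apply]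
      rw [← Finset.sum_add_distrib, ← h0]
      exact Finset.sum_congr rfl fun e _ => by ring
    have hgauge := congrFun (congrArg (Matrix.vecMul S) (transpose_mul_gauge (C := Cm) hBB hDB)) a
    rw [← Matrix.vecMul_vecMul] at hgauge
    have hL : ∑ β, (∑ b, B x β b * S b) * (Bm * Cm * Bm⁻¹ + Dm * Bm⁻¹) β a
        = ∑ b, S b * (∑ c, C x b c * B x a c - fderiv ℝ (fun z => B z a b) x (Y x)) := by
      simp only [Matrix.vecMul, dotProduct, Matrix.sub_apply, Matrix.mul_apply,
        Matrix.transpose_apply, hBm, hCm, hDm, Matrix.of_apply] at hgauge ⊢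
      rw [← hgauge]
      refine Finset.sum_congr rfl fun β _ => ?_
      congr 1
      exact Finset.sum_congr rfl fun b _ => mul_comm _ _
    have hR : ∑ β, D1 ((1 / √(η x)) • ∑ b, B x β b • fun k => σ x k b)
          * (Bm * Cm * Bm⁻¹ + Dm * Bm⁻¹) β a
        = (1 / √(η x)) * ∑ b, S b * (∑ c, C x b c * B x a c
          - fderiv ℝ (fun z => B z a b) x (Y x)) := by
      rw [← hL, Finset.mul_sum]
      refine Finset.sum_congr rfl fun β _ => ?_
      simp only [map_smul, map_sum, smul_eq_mul, hS]
      ring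
    rw [hR]
    simp only [map_add, map_sub, map_smul, map_sum, smul_eq_mul]
    have hswap : ∑ b, B x a b * ∑ c, C x c b * S c = ∑ b, S b * ∑ c, C x b c * B x a c := by
      simp only [Finset.mul_sum]
      rw [Finset.sum_comm]
      exact Finset.sum_congr rfl fun b _ => Finset.sum_congr rfl fun c _ => by ring
    have hτ : ∑ b, B x a b * (-(1/2) * τ x * S b) = -(1/2) * τ x * ∑ b, B x a b * S b := by
      rw [Finset.mul_sum]
      exact Finset.sum_congr rfl fun b _ => by ring
    have hcomm : ∑ b, fderiv ℝ (fun z => B z a b) x (Y x) * S b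
        = ∑ b, S b * fderiv ℝ (fun z => B z a b) x (Y x) :=
      Finset.sum_congr rfl fun b _ => mul_comm _ _
    change _ * ∑ b, B x a b * S b + _ * ∑ b, fderiv ℝ (fun z => B z a b) x (Y x) * S b
      + _ * ∑ b, B x a b * (-(1/2) * τ x * S b - ∑ c, C x c b * S c)
      = -(1/2) * _ * (_ * ∑ b, B x a b * S b) - _
    simp only [mul_sub, Finset.sum_sub_distrib]
    rw [hswap, hτ, hcomm]
    ring
  · intro y hy i
    obtain ⟨x, hx, rfl⟩ : ∃ x ∈ M, Φ x = y := by rwa [← hΦim] at hy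
    obtain ⟨hbr, hdr⟩ := hsym.vector_eqs hx (atM hμsmooth hx).differentiableAt_infty
      (fun a => (hs x hx a).differentiableAt_infty) (atM hYsmooth hx)
    have hη := atM hηsmooth hx
    have hη0 := (hηpos x hx).ne'
    have hLΦ : ContDiffAt ℝ (⊤ : ℕ∞)
        (diffusionOp μ (fun a z i => σ z i a) fun z => Φ z i) x :=
      (hΦi x hx i).diffusionOp (atM hμsmooth hx) (hs x hx)
    have hgen : (fun z => (1 / η z) * gen μ σ (fun z => Φ z i) z) =ᶠ[nhds x]
        fun z => (1 / η z) * diffusionOp μ (fun a z i => σ z i a) (fun z => Φ z i) z := by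
      filter_upwards [hMopen.mem_nhds hx] with z hz
      rw [gen_eq_diffusionOp μ σ (hΦi z hz i)]
    have hinv : ContDiffAt ℝ (⊤ : ℕ∞) (fun z => 1 / η z) x := contDiffAt_const.div hη hη0
    have hG := (hinv.mul hLΦ).congr_of_eventuallyEq hgen
    have hμfun : (fun y => transMu μ σ Φ Φinv η y i)
        = fun y => (fun z => (1 / η z) * gen μ σ (fun z => Φ z i) z) (Φinv y) := rfl
    have hBB : ∀ b c, ∑ a, B x a b * B x a c = if b = c then (1 : ℝ) else 0 := by
      have h1 : (Matrix.of (B x)) * (Matrix.of (B x)).transpose = 1 := by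
        ext a b
        simpa [Matrix.mul_apply, Matrix.one_apply] using hBorth x hx a b
      intro b c
      have h2 := congrArg (fun A : Matrix (Fin m) (Fin m) ℝ => A b c) (mul_eq_one_comm.1 h1)
      simpa [Matrix.mul_apply, Matrix.one_apply] using h2
    have hr : (1 / √(η x)) ^ 2 = 1 / η x := by
      rw [div_pow, Real.sq_sqrt (hηpos x hx).le, one_pow]
    have hgen' := diffusionOp_comp (v := μ) (s := fun a z i => σ z i a)
      (v' := transMu μ σ Φ Φinv η) (s' := fun a z i => transSigma σ Φ Φinv B η z i a)
      (r := 1 / √(η x)) (hpush _ x hx (hYΦ x hx i)) (atM hΦsmooth hx) hBB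
      (fun a => by rw [hsx x hx a]; simp only [map_smul, map_sum])
      (by
        ext j
        simp only [transMu, hΦleft x hx, hr]
        rw [gen_eq_diffusionOp μ σ (hΦi x hx j)]
        unfold diffusionOp
        simp only [sndFDeriv_apply_coord (atM hΦsmooth hx),
          fderiv_apply_coord (atM hΦsmooth hx).differentiableAt_infty]
        simp [Finset.sum_apply])
    have hloc : diffusionOp μ (fun a z i => σ z i a)
          (fun z => (fun z => fderiv ℝ (fun z => Φ z i) z (Y z)) (Φinv (Φ z))) x
        = diffusionOp μ (fun a z i => σ z i a) (fun z => fderiv ℝ (fun z => Φ z i) z (Y z)) x := by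
      have he := hpull (fun z => fderiv ℝ (fun z => Φ z i) z (Y z)) x hx
      unfold diffusionOp
      rw [he.fderiv_eq, he.fderiv.fderiv_eq]
    have hcomm := fderiv_diffusionOp_sub_eq (hΦi x hx i) (atM hμsmooth hx) (hs x hx)
      (atM hYsmooth hx) (hCso x hx) hbr hdr
    have hdinv : fderiv ℝ (fun z => 1 / η z) x (Y x) = -(fderiv ℝ η x (Y x)) / η x ^ 2 := by
      rw [show (fun z => 1 / η z) = (fun t : ℝ => t⁻¹) ∘ η from funext fun z => one_div _,
        ((hasDerivAt_inv hη0).comp_hasFDerivAt x hη.differentiableAt_infty.hasFDerivAt).fderiv]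
      simp only [_root_.smul_apply, smul_eq_mul]
      ring
    rw [vfApp_eq_fderiv, hpushVF x hx, hμfun, hpushd _ x hx hG, hgen.fderiv_eq, hpushVFfun,
      gen_eq_diffusionOp _ _ (hpush _ x hx (hYΦ x hx i)), hgen', hloc, hr,
      fderiv_fun_mul hinv.differentiableAt_infty hLΦ.differentiableAt_infty]
    simp only [_root_.add_apply, _root_.smul_apply, smul_eq_mul, hdinv, pushTau, transMu,
      hΦleft x hx, vfApp_eq_fderiv]
    rw [gen_eq_diffusionOp μ σ (hΦi x hx i)]
    linear_combination (1 / η x) * hcomm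
end
end
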